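/- arXiv:2212.05809 — 2 statements merged into one kernel-verified Lean document; each statement's English description precedes it below -/
import Mathlib

section
/- Let (u, b, p) be a smooth bounded solution of the stationary MHD/Hall–MHD system with parameter δ ∈ [0,1] on the slab ℝ²×𝕋, and suppose there exist constants C > 0 and α > 0 such that ∫_{{|x'| ≤ R}×[0,1]} (|∇u|² + |∇b|²) dx ≤ C R^α for all R > 1. If the functions x ↦ |x'| u^r(x) and x ↦ |x'| b^r(x) are bounded on ℝ³, then u and b are constant vectors. -/
open MeasureTheory

noncomputable section

/-- Points of `ℝ³`. -/
abbrev V3 : Type := Fin 3 → ℝ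

/-- Partial derivative `∂ᵢ f`. -/
def pd (i : Fin 3) (f : V3 → ℝ) (x : V3) : ℝ := fderiv ℝ f x (Pi.single i 1)

/-- Componentwise Laplacian. -/
def lap (f : V3 → ℝ) (x : V3) : ℝ := ∑ i, pd i (pd i f) x

/-- Cross product in `ℝ³`. -/
def cross3 (a c : V3) : V3 :=
  ![a 1 * c 2 - a 2 * c 1, a 2 * c 0 - a 0 * c 2, a 0 * c 1 - a 1 * c 0]

/-- Curl of a vector field. -/
def curl (b : V3 → V3) (x : V3) : V3 :=
  ![pd 1 (fun y => b y 2) x - pd 2 (fun y => b y 1) x,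
    pd 2 (fun y => b y 0) x - pd 0 (fun y => b y 2) x,
    pd 0 (fun y => b y 1) x - pd 1 (fun y => b y 0) x]

/-- Euclidean dot product in `ℝ³`. -/
def dot3 (a c : V3) : ℝ := ∑ i, a i * c i

/-- `|x'| = √(x₁² + x₂²)`. -/
def nr (x : V3) : ℝ := Real.sqrt ((x 0) ^ 2 + (x 1) ^ 2)

/-- The slab `ℝ² × [0,1]`. -/
def slab : Set V3 := {x | 0 ≤ x 2 ∧ x 2 ≤ 1}

/-- The region `{|x'| ≤ R} × [0,1]`. -/
def cylSet (R : ℝ) : Set V3 := {x | (0 ≤ x 2 ∧ x 2 ≤ 1) ∧ nr x ≤ R}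

/-- The annular region `O_R = {R-1 ≤ |x'| ≤ R} × [0,1]`. -/
def OR (R : ℝ) : Set V3 := {x | (0 ≤ x 2 ∧ x 2 ≤ 1) ∧ R - 1 ≤ nr x ∧ nr x ≤ R}

/-- The radial cut-off function `φ_R`. -/
def phiR (R : ℝ) (x : V3) : ℝ := min 1 (max 0 (R - nr x))

/-- `|∇u|² = Σ_{i,j} |∂ᵢ uʲ|²`. -/
def gradSq (u : V3 → V3) (x : V3) : ℝ := ∑ i, ∑ j, (pd i (fun y => u y j) x) ^ 2

/-- The `L²` norm of a scalar function on a set. -/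
def l2 (f : V3 → ℝ) (S : Set V3) : ℝ := Real.sqrt (∫ x in S, (f x) ^ 2)

/-- The radial component `u^r` as a function of `x`. -/
def ur (u : V3 → V3) (x : V3) : ℝ := (x 0 * u x 0 + x 1 * u x 1) / nr x

/-- The point with cylindrical coordinates `(r, θ, z)`. -/
def cylPt (r θ z : ℝ) : V3 := ![r * Real.cos θ, r * Real.sin θ, z]

/-- The radial component `u^r` in cylindrical coordinates. -/
def compR (u : V3 → V3) (r θ z : ℝ) : ℝ :=
  Real.cos θ * u (cylPt r θ z) 0 + Real.sin θ * u (cylPt r θ z) 1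

/-- The swirl component `u^θ` in cylindrical coordinates. -/
def compTheta (u : V3 → V3) (r θ z : ℝ) : ℝ :=
  -Real.sin θ * u (cylPt r θ z) 0 + Real.cos θ * u (cylPt r θ z) 1

/-- A cylindrical component is axisymmetric if it is independent of `θ`. -/
def AxiSym (f : ℝ → ℝ → ℝ → ℝ) : Prop := ∀ r θ₁ θ₂ z, f r θ₁ z = f r θ₂ z

/-- `1`-periodicity in the `x₃` variable. -/
def PeriodicZ (u : V3 → V3) : Prop := ∀ x : V3, u ![x 0, x 1, x 2 + 1] = u x

/-- Divergence-free vector field. -/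
def DivFree (u : V3 → V3) : Prop := ∀ x, ∑ i, pd i (fun y => u y i) x = 0

/-- Boundedness of a vector field. -/
def Bounded3 (u : V3 → V3) : Prop := ∃ M, ∀ x, ‖u x‖ ≤ M

/-- The stationary MHD (`δ = 0`) / Hall–MHD (`δ = 1`) system:
`(u·∇)u + ∇p − (b·∇)b − Δu = 0`,
`(u·∇)b − (b·∇)u − Δb = δ ∇×((∇×b)×b)`, `div u = div b = 0`. -/
def IsMHD (δ : ℝ) (u b : V3 → V3) (p : V3 → ℝ) : Prop :=
  (∀ x i, (∑ j, u x j * pd j (fun y => u y i) x) + pd i p x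
      - (∑ j, b x j * pd j (fun y => b y i) x) - lap (fun y => u y i) x = 0) ∧
  (∀ x i, (∑ j, u x j * pd j (fun y => b y i) x)
      - (∑ j, b x j * pd j (fun y => u y i) x) - lap (fun y => b y i) x
      = δ * curl (fun y => cross3 (curl b y) (b y)) x i) ∧
  DivFree u ∧ DivFree b

/-- Growth of the local Dirichlet integral: `∫_{{|x'|≤R}×[0,1]} |∇u|²+|∇b|² ≤ C R^α`. -/
def DirichletGrowth (u b : V3 → V3) : Prop :=
  ∃ C > (0:ℝ), ∃ α > (0:ℝ), ∀ R > (1:ℝ),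
    (∫ x in cylSet R, (gradSq u x + gradSq b x)) ≤ C * R ^ α

/-- Radial derivative `∂_r f = (x'/|x'|)·(∂₁f, ∂₂f)`. -/
def radD (f : V3 → ℝ) (x : V3) : ℝ := (x 0 / nr x) * pd 0 f x + (x 1 / nr x) * pd 1 f x

/-- The unit radial vector `(x'/|x'|, 0)`. -/
def er3 (x : V3) : V3 := ![x 0 / nr x, x 1 / nr x, 0]

/-- Squared Euclidean length of a vector of `ℝ³`. -/
def sq3 (v : V3) : ℝ := ∑ i, (v i) ^ 2

/-! ### Partial derivatives -/

/-- `1`-periodicity of a scalar function in the `x₃` variable. -/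
def ZPer (f : V3 → ℝ) : Prop := ∀ x, f (x + Pi.single 2 1) = f x

/-- Vanishing for large `|x'|`. -/
def HSupp (f : V3 → ℝ) : Prop := ∃ L, ∀ x, L ≤ nr x → f x = 0

lemma continuous_nr : Continuous nr := by unfold nr; fun_prop

lemma nr_add_single_two (x : V3) (s : ℝ) : nr (x + Pi.single 2 s) = nr x := by
  simp [nr]

lemma abs_zero_le_nr (x : V3) : |x 0| ≤ nr x :=
  Real.abs_le_sqrt (by nlinarith [sq_nonneg (x 1)])

lemma abs_one_le_nr (x : V3) : |x 1| ≤ nr x :=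
  Real.abs_le_sqrt (by nlinarith [sq_nonneg (x 0)])

section pd
variable {f g : V3 → ℝ} {i : Fin 3}

lemma pd_add (hf : Differentiable ℝ f) (hg : Differentiable ℝ g) (x : V3) :
    pd i (fun y => f y + g y) x = pd i f x + pd i g x := by
  simp [pd, fderiv_fun_add (hf x) (hg x)]

lemma pd_sub (hf : Differentiable ℝ f) (hg : Differentiable ℝ g) (x : V3) :
    pd i (fun y => f y - g y) x = pd i f x - pd i g x := by
  simp [pd, fderiv_fun_sub (hf x) (hg x)]

lemma pd_mul (hf : Differentiable ℝ f) (hg : Differentiable ℝ g) (x : V3) :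
    pd i (fun y => f y * g y) x = pd i f x * g x + f x * pd i g x := by
  simp [pd, fderiv_fun_mul (hf x) (hg x)]; ring

lemma pd_neg (x : V3) : pd i (fun y => - f y) x = - pd i f x := by
  simp [pd]

lemma pd_const_mul (c : ℝ) (hf : Differentiable ℝ f) (x : V3) :
    pd i (fun y => c * f y) x = c * pd i f x := by
  simp [pd, fderiv_const_mul (hf x) c]

lemma pd_const (c : ℝ) (x : V3) : pd i (fun _ => c) x = 0 := by
  simp [pd]

lemma pd_coord (j : Fin 3) (x : V3) :
    pd i (fun y => y j) x = (Pi.single i 1 : V3) j := by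
  have : HasFDerivAt (fun y : V3 => y j) (ContinuousLinearMap.proj (R := ℝ) j) x :=
    (ContinuousLinearMap.proj (R := ℝ) (φ := fun _ : Fin 3 => ℝ) j).hasFDerivAt
  simp [pd, this.fderiv]

lemma HasFDerivAt.pd_eq {f' : V3 →L[ℝ] ℝ} {x : V3} (h : HasFDerivAt f f' x) :
    pd i f x = f' (Pi.single i 1) := by
  simp [pd, h.fderiv]

lemma ContDiff.pd {m n : WithTop ℕ∞} (hf : ContDiff ℝ n f) (hmn : m + 1 ≤ n) (i : Fin 3) :
    ContDiff ℝ m (pd i f) :=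
  (hf.fderiv_right hmn).clm_apply contDiff_const

lemma ContDiff.pd_top (hf : ContDiff ℝ (⊤ : ℕ∞) f) (i : Fin 3) :
    ContDiff ℝ (⊤ : ℕ∞) (_root_.pd i f) := hf.pd (by simp) i

lemma ZPer.pd (hf : ZPer f) (i : Fin 3) : ZPer (pd i f) := by
  intro x
  have h : (fun y => f (y + Pi.single 2 1)) = f := funext hf
  have := fderiv_comp_add_right (𝕜 := ℝ) (f := f) (x := x) (Pi.single 2 1)
  rw [h] at this
  simp only [_root_.pd, this]

lemma HSupp.pd (hf : HSupp f) (i : Fin 3) : HSupp (pd i f) := by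
  obtain ⟨L, hL⟩ := hf
  refine ⟨L + 1, fun x hx => ?_⟩
  have : f =ᶠ[nhds x] fun _ => 0 := by
    filter_upwards [(isOpen_lt continuous_const continuous_nr).mem_nhds
      (show L < nr x by linarith)] with y hy
    exact hL y (le_of_lt hy)
  simp [_root_.pd, this.fderiv_eq]

lemma fderiv_apply_eq_sum_pd (f : V3 → ℝ) (x v : V3) :
    fderiv ℝ f x v = v 0 * pd 0 f x + v 1 * pd 1 f x + v 2 * pd 2 f x := by
  have hv : v = v 0 • Pi.single 0 1 + v 1 • Pi.single 1 1 + v 2 • Pi.single 2 1 := by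
    ext j; fin_cases j <;> simp
  conv_lhs => rw [hv]
  simp [pd]

end pd

lemma ZPer.mul {f g : V3 → ℝ} (hf : ZPer f) (hg : ZPer g) : ZPer (fun x => f x * g x) :=
  fun x => by simp only [hf x, hg x]

lemma ZPer.add {f g : V3 → ℝ} (hf : ZPer f) (hg : ZPer g) : ZPer (fun x => f x + g x) :=
  fun x => by simp only [hf x, hg x]

lemma ZPer.sub {f g : V3 → ℝ} (hf : ZPer f) (hg : ZPer g) : ZPer (fun x => f x - g x) :=
  fun x => by simp only [hf x, hg x]

lemma HSupp.mul_right {f : V3 → ℝ} (hf : HSupp f) (g : V3 → ℝ) : HSupp (fun x => f x * g x) :=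
  hf.imp fun L hL x hx => by simp [hL x hx]

lemma HSupp.mul_left {f : V3 → ℝ} (hf : HSupp f) (g : V3 → ℝ) : HSupp (fun x => g x * f x) :=
  hf.imp fun L hL x hx => by simp [hL x hx]

lemma HSupp.add {f g : V3 → ℝ} (hf : HSupp f) (hg : HSupp g) : HSupp (fun x => f x + g x) := by
  obtain ⟨L, hL⟩ := hf
  obtain ⟨L', hL'⟩ := hg
  exact ⟨max L L', fun x hx => by
    simp [hL x ((le_max_left _ _).trans hx), hL' x ((le_max_right _ _).trans hx)]⟩

lemma HSupp.sub {f g : V3 → ℝ} (hf : HSupp f) (hg : HSupp g) : HSupp (fun x => f x - g x) := by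
  obtain ⟨L, hL⟩ := hf
  obtain ⟨L', hL'⟩ := hg
  exact ⟨max L L', fun x hx => by
    simp [hL x ((le_max_left _ _).trans hx), hL' x ((le_max_right _ _).trans hx)]⟩

/-! ### Integration over the slab -/

/-- The box `[-L, L]² × [0, 1]`. -/
def box (L : ℝ) : Set V3 := Set.Icc ![-L, -L, 0] ![L, L, 1]

lemma mem_box {L : ℝ} {x : V3} :
    x ∈ box L ↔ (-L ≤ x 0 ∧ x 0 ≤ L) ∧ (-L ≤ x 1 ∧ x 1 ≤ L) ∧ 0 ≤ x 2 ∧ x 2 ≤ 1 := by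
  simp only [box, Set.mem_Icc, Pi.le_def, Fin.forall_fin_succ]
  simp
  tauto

lemma isClosed_slab : IsClosed slab :=
  (isClosed_le continuous_const (continuous_apply 2)).inter
    (isClosed_le (continuous_apply 2) continuous_const)

lemma measurableSet_slab : MeasurableSet slab := isClosed_slab.measurableSet

lemma box_subset_slab (L : ℝ) : box L ⊆ slab := fun _ hx => (mem_box.1 hx).2.2

lemma lt_nr_of_mem_slab_diff_box {L : ℝ} {x : V3} (hx : x ∈ slab \ box L) : L < nr x := by
  by_contra! h
  have h0 := abs_le.1 ((abs_zero_le_nr x).trans h)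
  have h1 := abs_le.1 ((abs_one_le_nr x).trans h)
  exact hx.2 (mem_box.2 ⟨h0, h1, hx.1⟩)

lemma Continuous.integrableOn_slab {f : V3 → ℝ} (hf : Continuous f) (hs : HSupp f) :
    IntegrableOn f slab := by
  obtain ⟨L, hL⟩ := hs
  have h : IntegrableOn f (box L) := hf.continuousOn.integrableOn_compact isCompact_Icc
  exact h.of_forall_sdiff_eq_zero measurableSet_slab
    fun x hx => hL x (lt_nr_of_mem_slab_diff_box hx).le

lemma integral_slab_eq_box {f : V3 → ℝ} {L : ℝ} (hL : ∀ x, L ≤ nr x → f x = 0) :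
    ∫ x in slab, f x = ∫ x in box L, f x :=
  (setIntegral_eq_of_subset_of_forall_sdiff_eq_zero measurableSet_slab (box_subset_slab L)
    fun x hx => hL x (lt_nr_of_mem_slab_diff_box hx).le)

lemma volume_real_box {L : ℝ} (hL : 0 ≤ L) : volume.real (box L) = 4 * L ^ 2 := by
  rw [box, Measure.real, Real.volume_Icc_pi_toReal]
  · simp [Fin.prod_univ_succ]; ring
  · intro i; fin_cases i <;> simp <;> linarith

/-- The integral over the slab of a partial derivative of a periodic, horizontally compactly
supported function vanishes. -/
lemma integral_slab_pd {f : V3 → ℝ} (hf : ContDiff ℝ 1 f) (hp : ZPer f) (hs : HSupp f)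
    (i : Fin 3) : ∫ x in slab, pd i f x = 0 := by
  obtain ⟨L₁, h₁⟩ := hs
  obtain ⟨L₂, h₂⟩ := (show HSupp f from ⟨L₁, h₁⟩).pd i
  set L := max 0 (max L₁ L₂) with hLdef
  have hL0 : 0 ≤ L := le_max_left _ _
  have h1 : ∀ x, L ≤ nr x → f x = 0 :=
    fun x hx => h₁ x (le_trans (by simp [hLdef]) hx)
  have h2 : ∀ x, L ≤ nr x → pd i f x = 0 :=
    fun x hx => h₂ x (le_trans (by simp [hLdef]) hx)
  rw [integral_slab_eq_box h2]
  have hle : (![-L, -L, 0] : V3) ≤ ![L, L, 1] := by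
    intro j; fin_cases j <;> simp <;> linarith
  have hd : ∀ x, HasFDerivAt f (fderiv ℝ f x) x :=
    fun x => (hf.differentiable (by simp) x).hasFDerivAt
  have hpd : Continuous (pd i f) := (hf.pd (m := 0) (by simp) i).continuous
  have key := integral_divergence_of_hasFDerivAt_off_countable' (E := ℝ) (n := 2)
    (![-L, -L, 0] : V3) ![L, L, 1] hle (fun j => if j = i then f else fun _ => 0)
    (fun j x => if j = i then fderiv ℝ f x else 0) ∅ Set.countable_empty
    (fun j => by
      split_ifs
      · exact hf.continuous.continuousOn
      · exact continuousOn_const)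
    (fun x _ j => by
      split_ifs
      · exact hd x
      · exact hasFDerivAt_const _ _)
    (by
      refine (hpd.continuousOn.integrableOn_compact isCompact_Icc).congr_fun (fun x _ => ?_)
        measurableSet_Icc
      simp [pd, DFunLike.ite_apply])
  have hlhs : ∀ x, ∑ j, (if j = i then fderiv ℝ f x else 0) (Pi.single j 1) = pd i f x := by
    intro x; simp [pd, DFunLike.ite_apply]
  simp only [hlhs] at key
  rw [box, key]
  refine Finset.sum_eq_zero fun j _ => ?_
  by_cases hj : j = i
  swap
  · simp [hj]
  simp only [hj, if_true]
  rw [sub_eq_zero]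
  refine integral_congr_ae (Filter.Eventually.of_forall fun y => ?_)
  fin_cases i
  · dsimp
    rw [h1, h1]
    · refine le_trans ?_ (abs_zero_le_nr _)
      simp [Fin.insertNth, le_abs_self]
    · refine le_trans ?_ (abs_zero_le_nr _)
      simp [Fin.insertNth, le_abs_self]
  · dsimp
    rw [h1, h1]
    · refine le_trans ?_ (abs_one_le_nr _)
      simp [Fin.insertNth, le_abs_self]
    · refine le_trans ?_ (abs_one_le_nr _)
      simp [Fin.insertNth, le_abs_self]
  · dsimp
    refine Eq.trans (congrArg f ?_) (hp _)
    ext k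
    fin_cases k
    · exact (add_zero (y 0)).symm
    · exact (add_zero (y 1)).symm
    · exact (zero_add (1 : ℝ)).symm

/-! ### Weighted averages in the vertical direction -/

/-- The vertical shift of a point. -/
def zsh (x : V3) (s : ℝ) : V3 := x + Pi.single 2 s

/-- The weighted vertical average `∫₀¹ k(s) f(x + s e₃) ds`. -/
def zAvg (k : ℝ → ℝ) (f : V3 → ℝ) (x : V3) : ℝ := ∫ s in (0:ℝ)..1, k s * f (zsh x s)

lemma continuous_zsh : Continuous fun q : V3 × ℝ => zsh q.1 q.2 := by
  unfold zsh
  exact continuous_fst.add ((continuous_single (A := fun _ : Fin 3 => ℝ) 2).comp continuous_snd)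

@[fun_prop]
lemma Continuous.zsh {X : Type*} [TopologicalSpace X] {a : X → V3} {s : X → ℝ}
    (ha : Continuous a) (hs : Continuous s) : Continuous fun x => zsh (a x) (s x) :=
  continuous_zsh.comp (ha.prodMk hs)

lemma hasFDerivAt_zsh (x : V3) (s : ℝ) :
    HasFDerivAt (fun y => zsh y s) (ContinuousLinearMap.id ℝ V3) x :=
  (hasFDerivAt_id x).add_const _

lemma zsh_zero_apply (x : V3) (s : ℝ) : zsh x s 0 = x 0 := by simp [zsh]

lemma zsh_one_apply (x : V3) (s : ℝ) : zsh x s 1 = x 1 := by simp [zsh]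

lemma zsh_zero (x : V3) : zsh x 0 = x := by simp [zsh]

lemma continuous_zAvg {k : ℝ → ℝ} {f : V3 → ℝ} (hk : Continuous k) (hf : Continuous f) :
    Continuous (zAvg k f) := by
  unfold zAvg
  exact intervalIntegral.continuous_parametric_intervalIntegral_of_continuous' (by fun_prop) 0 1

lemma hasFDerivAt_zAvg {k : ℝ → ℝ} {f : V3 → ℝ} (hk : Continuous k) (hf : ContDiff ℝ 1 f)
    (x : V3) :
    HasFDerivAt (zAvg k f) (∫ s in (0:ℝ)..1, k s • fderiv ℝ f (zsh x s)) x := by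
  have hf' : Continuous (fderiv ℝ f) := hf.continuous_fderiv (by simp)
  have hfc := hf.continuous
  have hF' : Continuous fun q : V3 × ℝ => k q.2 • fderiv ℝ f (zsh q.1 q.2) := by fun_prop
  obtain ⟨B, hB⟩ := ((isCompact_closedBall x 1).prod (isCompact_Icc (a := (0:ℝ)) (b := 1))).exists_bound_of_continuousOn
    hF'.continuousOn
  refine intervalIntegral.hasFDerivAt_integral_of_dominated_of_fderiv_le (bound := fun _ => B)
    (F' := fun y s => k s • fderiv ℝ f (zsh y s))
    (Metric.ball_mem_nhds x one_pos) (.of_forall fun y => ?_) ?_ ?_ ?_ ?_ ?_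
  · exact (show Continuous fun s => k s * f (zsh y s) by fun_prop).aestronglyMeasurable
  · exact (show Continuous fun s => k s * f (zsh x s) by fun_prop).intervalIntegrable _ _
  · exact (show Continuous fun s => k s • fderiv ℝ f (zsh x s) by fun_prop).aestronglyMeasurable
  · refine .of_forall fun s hs y hy => hB (y, s) ⟨Metric.ball_subset_closedBall hy, ?_⟩
    rw [Set.uIoc_of_le zero_le_one] at hs
    exact ⟨hs.1.le, hs.2⟩
  · exact intervalIntegrable_const
  · refine .of_forall fun s _ y _ => ?_
    have h := ((hf.differentiable (by simp) (zsh y s)).hasFDerivAt.comp y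
      (hasFDerivAt_zsh y s)).const_mul (k s)
    simpa using h

lemma contDiff_zAvg {k : ℝ → ℝ} {f : V3 → ℝ} (hk : Continuous k) (hf : ContDiff ℝ 1 f) :
    ContDiff ℝ 1 (zAvg k f) := by
  have hf' : Continuous (fderiv ℝ f) := hf.continuous_fderiv (by simp)
  refine contDiff_one_iff_hasFDerivAt.2 ⟨_, ?_, fun x => hasFDerivAt_zAvg hk hf x⟩
  exact intervalIntegral.continuous_parametric_intervalIntegral_of_continuous'
    (f := fun x s => k s • fderiv ℝ f (zsh x s)) (by fun_prop) 0 1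

lemma pd_zAvg {k : ℝ → ℝ} {f : V3 → ℝ} (hk : Continuous k) (hf : ContDiff ℝ 1 f) (i : Fin 3)
    (x : V3) : pd i (zAvg k f) x = zAvg k (pd i f) x := by
  have hf' : Continuous (fderiv ℝ f) := hf.continuous_fderiv (by simp)
  rw [(hasFDerivAt_zAvg hk hf x).pd_eq, ContinuousLinearMap.intervalIntegral_apply]
  · simp [zAvg, pd]
  · exact (show Continuous fun s => k s • fderiv ℝ f (zsh x s) by fun_prop).intervalIntegrable _ _

lemma ZPer.zAvg {f : V3 → ℝ} (hf : ZPer f) (k : ℝ → ℝ) : ZPer (zAvg k f) := by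
  intro x
  unfold _root_.zAvg
  congr 1
  ext s
  rw [← hf (zsh x s)]
  simp [zsh, add_right_comm]

lemma HSupp.zAvg {f : V3 → ℝ} (hf : HSupp f) (k : ℝ → ℝ) : HSupp (zAvg k f) :=
  hf.imp fun L hL x hx => by
    have : ∀ s, f (zsh x s) = 0 := fun s => hL _ (by rwa [zsh, nr_add_single_two])
    simp [_root_.zAvg, this]

lemma abs_zAvg_le {k : ℝ → ℝ} {f : V3 → ℝ} {M : ℝ} (hk : ∀ s ∈ Set.Ioc (0:ℝ) 1, |k s| ≤ 1)
    (hf : ∀ x, |f x| ≤ M) (x : V3) : |zAvg k f x| ≤ M := by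
  have h := intervalIntegral.norm_integral_le_of_norm_le_const (a := 0) (b := 1) (C := M)
    (f := fun s => k s * f (zsh x s)) (fun s hs => by
      rw [Set.uIoc_of_le zero_le_one] at hs
      rw [Real.norm_eq_abs, abs_mul]
      exact (mul_le_of_le_one_left (abs_nonneg _) (hk s hs)).trans (hf _))
  simpa [zAvg] using h

lemma hasDerivAt_comp_zsh {f : V3 → ℝ} (hf : Differentiable ℝ f) (x : V3) (s : ℝ) :
    HasDerivAt (fun s => f (zsh x s)) (pd 2 f (zsh x s)) s := by
  have h : HasDerivAt (fun s => zsh x s) (Pi.single 2 1) s := by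
    unfold zsh
    refine HasDerivAt.const_add x (hasDerivAt_pi.2 fun j => ?_)
    by_cases hj : j = 2
    · subst hj; simpa using hasDerivAt_id' s
    · simpa [hj] using hasDerivAt_const s (0:ℝ)
  exact (hf _).hasFDerivAt.comp_hasDerivAt s h

lemma pd_two_zAvg_one {f : V3 → ℝ} (hf : ContDiff ℝ 1 f) (hp : ZPer f) (x : V3) :
    pd 2 (zAvg (fun _ => 1) f) x = 0 := by
  have hc : Continuous (pd 2 f) := (hf.pd (m := 0) (by simp) 2).continuous
  rw [pd_zAvg continuous_const hf]
  simp only [zAvg, one_mul]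
  rw [intervalIntegral.integral_eq_sub_of_hasDerivAt
    (fun s _ => hasDerivAt_comp_zsh (hf.differentiable (by simp)) x s)
    ((show Continuous fun s => pd 2 f (zsh x s) by fun_prop).intervalIntegrable _ _)]
  rw [zsh_zero, zsh, hp, sub_self]

lemma pd_two_zAvg_id {f : V3 → ℝ} (hf : ContDiff ℝ 1 f) (hp : ZPer f) (x : V3) :
    pd 2 (zAvg id f) x = f x - zAvg (fun _ => 1) f x := by
  have hc : Continuous (pd 2 f) := (hf.pd (m := 0) (by simp) 2).continuous
  rw [pd_zAvg continuous_id hf]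
  simp only [zAvg, one_mul, id]
  rw [intervalIntegral.integral_mul_deriv_eq_deriv_mul (u := fun s => s) (u' := fun _ => 1)
    (fun s _ => hasDerivAt_id s)
    (fun s _ => hasDerivAt_comp_zsh (hf.differentiable (by simp)) x s)
    intervalIntegrable_const
    ((show Continuous fun s => pd 2 f (zsh x s) by fun_prop).intervalIntegrable _ _)]
  simp [zsh, hp x]

lemma integral_slab_mul_zAvg {η f : V3 → ℝ} (hη : ContDiff ℝ 1 η) (hf : ContDiff ℝ 1 f)
    (hηz : ∀ x s, η (zsh x s) = η x) (hηs : HSupp η) (hp : ZPer f) :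
    ∫ x in slab, η x * zAvg (fun _ => 1) f x = ∫ x in slab, η x * f x := by
  have hm : ContDiff ℝ 1 fun x => η x * f x := hη.mul hf
  have hmp : ZPer fun x => η x * f x := ZPer.mul (fun x => hηz x 1) hp
  have h0 := integral_slab_pd (contDiff_zAvg continuous_id hm) (hmp.zAvg id)
    ((hηs.mul_right f).zAvg id) 2
  have hav : ∀ x, zAvg (fun _ => 1) (fun x => η x * f x) x
      = η x * zAvg (fun _ => 1) f x := by
    intro x
    simp only [zAvg, one_mul, hηz]
    exact intervalIntegral.integral_const_mul _ _
  simp only [pd_two_zAvg_id hm hmp, hav] at h0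
  rw [integral_sub (hm.continuous.integrableOn_slab (hηs.mul_right f))
    ((show Continuous fun x => η x * zAvg (fun _ => 1) f x from
      hη.continuous.mul (continuous_zAvg continuous_const hf.continuous)).integrableOn_slab
      (hηs.mul_right _))] at h0
  linarith

/-! ### Horizontal cut-off functions -/

/-- A smooth profile equal to `1` on `(-∞, 1]` and to `0` on `[4, ∞)`. -/
def chi (t : ℝ) : ℝ := Real.smoothTransition ((4 - t) / 3)

/-- The squared horizontal radius. -/
def rsq (x : V3) : ℝ := x 0 ^ 2 + x 1 ^ 2

/-- The horizontal part of the position vector. -/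
def hpos (k : Fin 3) (x : V3) : ℝ := if k = 2 then 0 else x k

/-- The smooth cut-off function at horizontal scale `R`. -/
def cut (R : ℝ) (x : V3) : ℝ := chi (rsq x / R ^ 2)

/-- A smooth function equal to `1` on the support of the derivatives of `cut R`. -/
def eta (R : ℝ) (x : V3) : ℝ := cut (2 * R) x - cut (R / 2) x

lemma contDiff_chi {n : ℕ∞} : ContDiff ℝ n chi :=
  Real.smoothTransition.contDiff.comp ((contDiff_const.sub contDiff_id).div_const 3)

lemma chi_of_le {t : ℝ} (h : t ≤ 1) : chi t = 1 :=
  Real.smoothTransition.one_of_one_le (by linarith)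

lemma chi_of_ge {t : ℝ} (h : 4 ≤ t) : chi t = 0 :=
  Real.smoothTransition.zero_of_nonpos (by linarith)

lemma chi_nonneg (t : ℝ) : 0 ≤ chi t := Real.smoothTransition.nonneg _

lemma chi_le_one (t : ℝ) : chi t ≤ 1 := Real.smoothTransition.le_one _

lemma deriv_chi_eq_zero {t : ℝ} (h : t < 1 ∨ 4 < t) : deriv chi t = 0 := by
  rcases h with h | h
  · have : chi =ᶠ[nhds t] fun _ => 1 := by
      filter_upwards [Iio_mem_nhds h] with s hs using chi_of_le (le_of_lt hs)
    simp [this.deriv_eq]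
  · have : chi =ᶠ[nhds t] fun _ => 0 := by
      filter_upwards [Ioi_mem_nhds h] with s hs using chi_of_ge (le_of_lt hs)
    simp [this.deriv_eq]

lemma deriv_deriv_chi_eq_zero {t : ℝ} (h : t < 1 ∨ 4 < t) : deriv (deriv chi) t = 0 := by
  have : deriv chi =ᶠ[nhds t] fun _ => 0 := by
    rcases h with h | h
    · filter_upwards [Iio_mem_nhds h] with s hs using deriv_chi_eq_zero (Or.inl hs)
    · filter_upwards [Ioi_mem_nhds h] with s hs using deriv_chi_eq_zero (Or.inr hs)
  simp [this.deriv_eq]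

lemma contDiff_deriv_chi {n : ℕ} : ContDiff ℝ n (deriv chi) :=
  ((contDiff_succ_iff_deriv (n := n)).1 (contDiff_chi (n := n + 1))).2.2

lemma exists_bound_deriv_chi :
    ∃ B, 0 ≤ B ∧ (∀ t, |deriv chi t| ≤ B) ∧ ∀ t, |deriv (deriv chi) t| ≤ B := by
  have h1 : Continuous (deriv chi) := (contDiff_deriv_chi (n := 0)).continuous
  have h2 : Continuous (deriv (deriv chi)) :=
    (contDiff_deriv_chi (n := 1)).continuous_deriv (by simp)
  obtain ⟨B₁, hB₁⟩ := isCompact_Icc.exists_bound_of_continuousOn (s := Set.Icc (1:ℝ) 4)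
    h1.continuousOn
  obtain ⟨B₂, hB₂⟩ := isCompact_Icc.exists_bound_of_continuousOn (s := Set.Icc (1:ℝ) 4)
    h2.continuousOn
  refine ⟨max 0 (max B₁ B₂), le_max_left _ _, fun t => ?_, fun t => ?_⟩ <;>
    by_cases ht : t ∈ Set.Icc (1:ℝ) 4
  · exact (hB₁ t ht).trans (by simp)
  · rw [deriv_chi_eq_zero, abs_zero]
    · exact le_max_left _ _
    · by_contra! h; exact ht ⟨h.1, h.2⟩
  · exact (hB₂ t ht).trans (by simp)
  · rw [deriv_deriv_chi_eq_zero, abs_zero]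
    · exact le_max_left _ _
    · by_contra! h; exact ht ⟨h.1, h.2⟩

lemma nr_eq (x : V3) : nr x = √(rsq x) := rfl

lemma rsq_eq (x : V3) : rsq x = nr x ^ 2 := by
  rw [nr_eq, Real.sq_sqrt]; unfold rsq; positivity

lemma contDiff_rsq {n : WithTop ℕ∞} : ContDiff ℝ n rsq := by unfold rsq; fun_prop

lemma contDiff_hpos {n : WithTop ℕ∞} (k : Fin 3) : ContDiff ℝ n (hpos k) := by
  unfold hpos; split_ifs <;> fun_prop

lemma contDiff_cut {n : ℕ∞} (R : ℝ) : ContDiff ℝ n (cut R) :=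
  contDiff_chi.comp (contDiff_rsq.div_const _)

lemma pd_comp_rsq {g : ℝ → ℝ} (hg : Differentiable ℝ g) (R : ℝ) (k : Fin 3) (x : V3) :
    pd k (fun y => g (rsq y / R ^ 2)) x = deriv g (rsq x / R ^ 2) * (2 * hpos k x / R ^ 2) := by
  have hc : ∀ j : Fin 3, HasFDerivAt (fun y : V3 => y j)
      (ContinuousLinearMap.proj (R := ℝ) (φ := fun _ : Fin 3 => ℝ) j) x := fun j =>
    (ContinuousLinearMap.proj (R := ℝ) (φ := fun _ : Fin 3 => ℝ) j).hasFDerivAt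
  have hr := (((hc 0).pow 2).add ((hc 1).pow 2)).mul_const (R ^ 2)⁻¹
  have h := (hg (rsq x / R ^ 2)).hasDerivAt.comp_hasFDerivAt x hr
  refine (HasFDerivAt.pd_eq h).trans ?_
  fin_cases k <;> simp [hpos, div_eq_mul_inv] <;> left <;> ring

lemma pd_cut (R : ℝ) (k : Fin 3) (x : V3) :
    pd k (cut R) x = deriv chi (rsq x / R ^ 2) * (2 * hpos k x / R ^ 2) :=
  pd_comp_rsq ((contDiff_chi (n := 1)).differentiable (by simp)) R k x

lemma pd_hpos (l k : Fin 3) (x : V3) :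
    pd l (hpos k) x = if l = k ∧ k ≠ 2 then 1 else 0 := by
  unfold hpos
  by_cases hk : k = 2
  · simp [hk, pd_const]
  · simp only [hk, if_false]
    rw [pd_coord]
    by_cases h : l = k <;> simp [h, hk, eq_comm]

lemma pd_pd_cut (R : ℝ) (l k : Fin 3) (x : V3) :
    pd l (pd k (cut R)) x
      = deriv (deriv chi) (rsq x / R ^ 2) * (2 * hpos l x / R ^ 2) * (2 * hpos k x / R ^ 2)
        + deriv chi (rsq x / R ^ 2) * (2 / R ^ 2 * pd l (hpos k) x) := by
  have hd : Differentiable ℝ (deriv chi) :=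
    (contDiff_deriv_chi (n := 1)).differentiable (by simp)
  have he : pd k (cut R) = fun y => deriv chi (rsq y / R ^ 2) * (2 / R ^ 2 * hpos k y) := by
    ext y; rw [pd_cut]; ring
  have hd' : Differentiable ℝ fun y => deriv chi (rsq y / R ^ 2) :=
    hd.comp (((contDiff_rsq (n := 1)).div_const (R ^ 2)).differentiable (by simp))
  rw [he, pd_mul hd' (((contDiff_hpos (n := 1) k).differentiable (by simp)).const_mul _), pd_comp_rsq hd,
    pd_const_mul _ ((contDiff_hpos (n := 1) k).differentiable (by simp))]
  ring

lemma cut_nonneg (R : ℝ) (x : V3) : 0 ≤ cut R x := chi_nonneg _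

lemma cut_le_one (R : ℝ) (x : V3) : cut R x ≤ 1 := chi_le_one _

lemma cut_zsh (R : ℝ) (x : V3) (s : ℝ) : cut R (zsh x s) = cut R x := by
  simp [cut, rsq, zsh_zero_apply, zsh_one_apply]

lemma cut_eq_one {R : ℝ} (hR : 0 < R) {x : V3} (h : nr x ≤ R) : cut R x = 1 := by
  refine chi_of_le ((div_le_one (by positivity)).2 ?_)
  rw [rsq_eq]
  exact pow_le_pow_left₀ (Real.sqrt_nonneg _) h 2

lemma cut_eq_zero {R : ℝ} (hR : 0 < R) {x : V3} (h : 2 * R ≤ nr x) : cut R x = 0 := by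
  refine chi_of_ge ((le_div_iff₀ (by positivity)).2 ?_)
  rw [rsq_eq]
  nlinarith

lemma hSupp_cut {R : ℝ} (hR : 0 < R) : HSupp (cut R) := ⟨2 * R, fun _ => cut_eq_zero hR⟩

lemma zPer_cut (R : ℝ) : ZPer (cut R) := fun x => cut_zsh R x 1

lemma contDiff_eta {n : ℕ∞} (R : ℝ) : ContDiff ℝ n (eta R) :=
  (contDiff_cut _).sub (contDiff_cut _)

lemma eta_zsh (R : ℝ) (x : V3) (s : ℝ) : eta R (zsh x s) = eta R x := by
  simp [eta, cut_zsh]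

lemma eta_nonneg {R : ℝ} (hR : 0 < R) (x : V3) : 0 ≤ eta R x := by
  unfold eta
  rcases le_total (nr x) (2 * R) with h | h
  · rw [cut_eq_one (by positivity) h]; linarith [cut_le_one (R / 2) x]
  · rw [cut_eq_zero (R := R / 2) (by positivity) (by linarith)]
    linarith [cut_nonneg (2 * R) x]

lemma eta_le_one (R : ℝ) (x : V3) : eta R x ≤ 1 := by
  unfold eta; linarith [cut_le_one (2 * R) x, cut_nonneg (R / 2) x]

lemma eta_eq_one {R : ℝ} (hR : 0 < R) {x : V3} (h₁ : R ≤ nr x) (h₂ : nr x ≤ 2 * R) :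
    eta R x = 1 := by
  rw [eta, cut_eq_one (by positivity) h₂, cut_eq_zero (by positivity) (by linarith), sub_zero]

lemma eta_eq_zero {R : ℝ} (hR : 0 < R) {x : V3} (h : 4 * R ≤ nr x) : eta R x = 0 := by
  rw [eta, cut_eq_zero (R := 2 * R) (by positivity) (by linarith),
    cut_eq_zero (R := R / 2) (by positivity) (by linarith), sub_zero]

lemma hSupp_eta {R : ℝ} (hR : 0 < R) : HSupp (eta R) := ⟨4 * R, fun _ => eta_eq_zero hR⟩

lemma abs_hpos_le_nr (k : Fin 3) (x : V3) : |hpos k x| ≤ nr x := by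
  fin_cases k
  · exact abs_zero_le_nr x
  · exact abs_one_le_nr x
  · simp [hpos, nr]

/-- First and second derivatives of `cut R` are bounded by multiples of `R⁻¹ eta R`. -/
lemma exists_bound_pd_cut :
    ∃ K, 0 ≤ K ∧ ∀ R ≥ 1, ∀ x, (∀ k, |pd k (cut R) x| ≤ K / R * eta R x) ∧
      ∀ l k, |pd l (pd k (cut R)) x| ≤ K / R * eta R x := by
  obtain ⟨B, hB, hB₁, hB₂⟩ := exists_bound_deriv_chi
  refine ⟨18 * B, by positivity, fun R hR x => ?_⟩
  have hR0 : 0 < R := by linarith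
  by_cases hx : R ≤ nr x ∧ nr x ≤ 2 * R
  · have hh : ∀ k, |2 * hpos k x / R ^ 2| ≤ 4 / R := fun k => by
      rw [abs_div, abs_mul, abs_of_pos (by positivity : 0 < R ^ 2), div_le_div_iff₀ (by positivity)
        hR0, abs_two]
      have := (abs_hpos_le_nr k x).trans hx.2
      nlinarith
    rw [eta_eq_one hR0 hx.1 hx.2, mul_one]
    refine ⟨fun k => ?_, fun l k => ?_⟩
    · rw [pd_cut, abs_mul]
      calc _ ≤ B * (4 / R) := mul_le_mul (hB₁ _) (hh k) (abs_nonneg _) hB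
        _ ≤ 18 * B / R := by
          rw [mul_div_assoc', div_le_div_iff_of_pos_right hR0]; linarith
    · have hp : |2 / R ^ 2 * pd l (hpos k) x| ≤ 2 / R := by
        have h1 : |pd l (hpos k) x| ≤ 1 := by rw [pd_hpos]; split_ifs <;> simp
        have h2 : 2 / R ^ 2 ≤ 2 / R :=
          div_le_div_of_nonneg_left (by norm_num) hR0 (by nlinarith)
        rw [abs_mul, abs_of_pos (by positivity : 0 < 2 / R ^ 2)]
        nlinarith [abs_nonneg (pd l (hpos k) x), (by positivity : 0 < 2 / R ^ 2)]
      rw [pd_pd_cut]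
      refine (abs_add_le _ _).trans ?_
      rw [abs_mul, abs_mul, abs_mul]
      have h3 : 4 / R * (4 / R) ≤ 16 / R := by
        rw [div_mul_div_comm, div_le_div_iff₀ (by positivity) hR0]; nlinarith
      calc _ ≤ B * (4 / R) * (4 / R) + B * (2 / R) := by
            gcongr
            exacts [hB₂ _, hh l, hh k, hB₁ _]
        _ ≤ B * (16 / R) + B * (2 / R) := by
            rw [mul_assoc]; gcongr
        _ = 18 * B / R := by ring
  · have ht : rsq x / R ^ 2 < 1 ∨ 4 < rsq x / R ^ 2 := by
      rw [div_lt_one (by positivity), lt_div_iff₀ (by positivity), rsq_eq]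
      rw [not_and_or, not_le, not_le] at hx
      have h0 : 0 ≤ nr x := Real.sqrt_nonneg _
      refine hx.imp (fun h => ?_) fun h => ?_ <;> nlinarith
    have := eta_nonneg hR0 x
    refine ⟨fun k => ?_, fun l k => ?_⟩
    · rw [pd_cut, deriv_chi_eq_zero ht, zero_mul, abs_zero]; positivity
    · rw [pd_pd_cut, deriv_chi_eq_zero ht, deriv_deriv_chi_eq_zero ht]
      simp only [zero_mul, add_zero, abs_zero]; positivity

/-! ### Solving `div Ψ = v · ∇(cut R)` -/

/-- Smooth, bounded, periodic, divergence-free vector fields with `|x'| vʳ` bounded. -/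
structure Adm (M : ℝ) (v : V3 → V3) : Prop where
  smooth : ∀ i, ContDiff ℝ (⊤ : ℕ∞) fun x => v x i
  bound : ∀ x i, |v x i| ≤ M
  per : ∀ i, ZPer fun x => v x i
  div : DivFree v
  radial : ∀ x, |x 0 * v x 0 + x 1 * v x 1| ≤ M

namespace Adm
variable {M : ℝ} {v : V3 → V3}

lemma nonneg (h : Adm M v) : 0 ≤ M := (abs_nonneg _).trans (h.bound 0 0)

lemma contDiff_one (h : Adm M v) (i : Fin 3) : ContDiff ℝ 1 fun x => v x i :=
  (h.smooth i).of_le (by exact_mod_cast le_top)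

lemma contDiff_pd (h : Adm M v) (i j : Fin 3) : ContDiff ℝ 1 (pd j fun x => v x i) :=
  ((h.smooth i).pd_top j).of_le (by exact_mod_cast le_top)

lemma contDiff_gradSq (h : Adm M v) : ContDiff ℝ 1 (gradSq v) := by
  unfold gradSq
  exact ContDiff.sum fun i _ => ContDiff.sum fun j _ => (h.contDiff_pd j i).pow 2

lemma zPer_gradSq (h : Adm M v) : ZPer (gradSq v) := by
  intro x
  unfold gradSq
  exact Finset.sum_congr rfl fun i _ => Finset.sum_congr rfl fun j _ => by
    rw [(h.per j).pd i x]

end Adm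

lemma sq_pd_le_gradSq (v : V3 → V3) (i j : Fin 3) (x : V3) :
    (pd j (fun y => v y i) x) ^ 2 ≤ gradSq v x := by
  unfold gradSq
  refine le_trans ?_ (Finset.single_le_sum (f := fun k => ∑ l, (pd k (fun y => v y l) x) ^ 2)
    (fun k _ => Finset.sum_nonneg fun l _ => sq_nonneg _) (Finset.mem_univ j))
  exact Finset.single_le_sum (f := fun l => (pd j (fun y => v y l) x) ^ 2)
    (fun l _ => sq_nonneg _) (Finset.mem_univ i)

lemma gradSq_nonneg (v : V3 → V3) (x : V3) : 0 ≤ gradSq v x :=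
  (sq_nonneg _).trans (sq_pd_le_gradSq v 0 0 x)

/-- The vertical average of a component. -/
def vbar (v : V3 → V3) (i : Fin 3) : V3 → ℝ := zAvg (fun _ => 1) fun x => v x i

section stream
variable {M : ℝ} {v : V3 → V3}

lemma Adm.contDiff_vbar (h : Adm M v) (i : Fin 3) : ContDiff ℝ 1 (vbar v i) :=
  contDiff_zAvg continuous_const (h.contDiff_one i)

lemma Adm.abs_vbar_le (h : Adm M v) (i : Fin 3) (x : V3) : |vbar v i x| ≤ M :=
  abs_zAvg_le (by simp) (fun x => h.bound x i) x

lemma Adm.pd_two_vbar (h : Adm M v) (i : Fin 3) (x : V3) : pd 2 (vbar v i) x = 0 :=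
  pd_two_zAvg_one (h.contDiff_one i) (h.per i) x

lemma Adm.div_vbar (h : Adm M v) (x : V3) : pd 0 (vbar v 0) x + pd 1 (vbar v 1) x = 0 := by
  have hc : ∀ i j, Continuous (pd j fun x => v x i) := fun i j => (h.contDiff_pd i j).continuous
  have h2 := h.pd_two_vbar 2 x
  have hi : ∀ i j, IntervalIntegrable (fun s => pd j (fun y => v y i) (zsh x s)) volume 0 1 :=
    fun i j => ((hc i j).comp (continuous_const.zsh continuous_id)).intervalIntegrable _ _
  rw [vbar, pd_zAvg continuous_const (h.contDiff_one _)] at *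
  rw [vbar, pd_zAvg continuous_const (h.contDiff_one _)]
  simp only [zAvg, one_mul] at *
  have hd : ∀ s, pd 0 (fun y => v y 0) (zsh x s) + pd 1 (fun y => v y 1) (zsh x s)
      + pd 2 (fun y => v y 2) (zsh x s) = 0 := fun s => by
    have := h.div (zsh x s)
    rwa [Fin.sum_univ_three] at this
  have h3 := intervalIntegral.integral_add ((hi 0 0).add (hi 1 1)) (hi 2 2)
  rw [intervalIntegral.integral_add (hi 0 0) (hi 1 1)] at h3
  simp only [hd, intervalIntegral.integral_zero] at h3
  linarith

lemma Adm.abs_radial_vbar_le (h : Adm M v) (x : V3) :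
    |x 0 * vbar v 0 x + x 1 * vbar v 1 x| ≤ M := by
  have hc : ∀ i, Continuous (fun x => v x i) := fun i => (h.contDiff_one i).continuous
  have hi : ∀ i, IntervalIntegrable (fun s => x i * v (zsh x s) i) volume 0 1 :=
    fun i => (((hc i).comp (continuous_const.zsh continuous_id)).const_mul _).intervalIntegrable _ _
  have he : x 0 * vbar v 0 x + x 1 * vbar v 1 x
      = zAvg (fun _ => 1) (fun y => y 0 * v y 0 + y 1 * v y 1) x := by
    simp only [vbar, zAvg, one_mul, zsh_zero_apply, zsh_one_apply]
    rw [intervalIntegral.integral_add (hi 0) (hi 1), intervalIntegral.integral_const_mul,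
      intervalIntegral.integral_const_mul]
  rw [he]
  exact abs_zAvg_le (by simp) h.radial x

/-- The vertically averaged field has a stream function. -/
lemma Adm.exists_stream (h : Adm M v) : ∃ ψ : V3 → ℝ, ContDiff ℝ 1 ψ ∧
    (∀ x, pd 0 ψ x = vbar v 1 x) ∧ (∀ x, pd 1 ψ x = - vbar v 0 x) ∧ ∀ x, pd 2 ψ x = 0 := by
  set pr : Fin 3 → V3 →L[ℝ] ℝ := fun i => ContinuousLinearMap.proj (R := ℝ) i with hpr
  set ω : V3 → V3 →L[ℝ] ℝ := fun x => vbar v 1 x • pr 0 - vbar v 0 x • pr 1 with hω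
  have hωc : Continuous ω :=
    ((h.contDiff_vbar 1).continuous.smul continuous_const).sub
      ((h.contDiff_vbar 0).continuous.smul continuous_const)
  have hd : ∀ i x, HasFDerivAt (vbar v i) (fderiv ℝ (vbar v i) x) x := fun i x =>
    ((h.contDiff_vbar i).differentiable (by simp) x).hasFDerivAt
  have hωd : ∀ x, HasFDerivAt ω ((fderiv ℝ (vbar v 1) x).smulRight (pr 0)
      - (fderiv ℝ (vbar v 0) x).smulRight (pr 1)) x := fun x =>
    ((hd 1 x).smul_const (pr 0)).sub ((hd 0 x).smul_const (pr 1))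
  obtain ⟨ψ, hψ⟩ := (convex_univ (𝕜 := ℝ) (E := V3)).exists_forall_hasFDerivWithinAt_of_hasFDerivWithinAt_symmetric
    (fun x _ => (hωd x).hasFDerivWithinAt) (fun a _ x _ y _ => by
      simp only [sub_apply, ContinuousLinearMap.smulRight_apply,
        smul_apply, fderiv_apply_eq_sum_pd, h.pd_two_vbar, smul_eq_mul, hpr,
        ContinuousLinearMap.proj_apply]
      linear_combination (x 1 * y 0 - x 0 * y 1) * h.div_vbar a)
  have hψ' : ∀ x, HasFDerivAt ψ (ω x) x := fun x => by simpa using hψ x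
  refine ⟨ψ, contDiff_one_iff_hasFDerivAt.2 ⟨ω, hωc, hψ'⟩, fun x => ?_, fun x => ?_, fun x => ?_⟩ <;>
    simp [(hψ' x).pd_eq, hω, hpr]

/-- A radial horizontal projection of a point to the half-plane `x₂ = 0`. -/
def halfPt (x : V3) : V3 := ![√(1 + rsq x), 0, x 2]

lemma rsq_nonneg (x : V3) : 0 ≤ rsq x := by unfold rsq; positivity

lemma contDiff_halfPt : ContDiff ℝ 1 halfPt := by
  rw [contDiff_pi]
  intro i
  fin_cases i
  · exact (contDiff_const.add contDiff_rsq).sqrt fun x => by have := rsq_nonneg x; positivity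
  · exact contDiff_const
  · exact contDiff_apply ℝ ℝ (2 : Fin 3)

lemma pd_sqrt_rsq (k : Fin 3) (x : V3) :
    pd k (fun y => √(1 + rsq y)) x = hpos k x / √(1 + rsq x) := by
  have hr : pd k rsq x = 2 * hpos k x := by
    simpa using pd_comp_rsq (g := id) differentiable_id 1 k x
  have h0 := rsq_nonneg x
  have hd : HasFDerivAt rsq (fderiv ℝ rsq x) x :=
    ((contDiff_rsq (n := 1)).differentiable (by simp) x).hasFDerivAt
  have := ((hd.const_add 1).sqrt (by positivity)).pd_eq (i := k)
  rw [this]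
  change 1 / (2 * √(1 + rsq x)) * pd k rsq x = _
  rw [hr]
  field_simp

variable {ψ : V3 → ℝ}

lemma pd_comp_halfPt (hψ : ContDiff ℝ 1 ψ) (h2 : ∀ x, pd 2 ψ x = 0) (k : Fin 3) (x : V3) :
    pd k (fun y => ψ (halfPt y)) x = hpos k x / √(1 + rsq x) * pd 0 ψ (halfPt x) := by
  have hP : HasFDerivAt halfPt (fderiv ℝ halfPt x) x :=
    (contDiff_halfPt.differentiable (by simp) x).hasFDerivAt
  have hc : ∀ j, pd k (fun y => halfPt y j) x = fderiv ℝ halfPt x (Pi.single k 1) j := fun j =>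
    HasFDerivAt.pd_eq (hasFDerivAt_pi'.1 hP j)
  have h := (((hψ.differentiable (by simp)) (halfPt x)).hasFDerivAt.comp x hP).pd_eq (i := k)
  refine Eq.trans h ?_
  rw [ContinuousLinearMap.comp_apply, fderiv_apply_eq_sum_pd, h2, ← hc 0, ← hc 1]
  have e0 : (fun y => halfPt y 0) = fun y => √(1 + rsq y) := rfl
  have e1 : (fun y => halfPt y 1) = fun _ => 0 := rfl
  rw [e0, e1, pd_sqrt_rsq, pd_const]
  ring

lemma abs_hpos_div_le (k : Fin 3) (x : V3) : |hpos k x / √(1 + rsq x)| ≤ 1 := by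
  have h0 := rsq_nonneg x
  rw [abs_div, abs_of_nonneg (Real.sqrt_nonneg _), div_le_one (by positivity)]
  exact (abs_hpos_le_nr k x).trans (Real.sqrt_le_sqrt (by unfold rsq; linarith))

/-- A function whose directional derivatives along a curve are bounded is Lipschitz along it. -/
lemma abs_sub_le_of_curve (hψ : ContDiff ℝ 1 ψ) {γ γ' : ℝ → V3} {C : ℝ}
    (hγ : ∀ t i, HasDerivAt (fun s => γ s i) (γ' t i) t)
    (hC : ∀ t, |γ' t 0 * pd 0 ψ (γ t) + γ' t 1 * pd 1 ψ (γ t) + γ' t 2 * pd 2 ψ (γ t)| ≤ C)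
    (s t : ℝ) : |ψ (γ t) - ψ (γ s)| ≤ C * |t - s| := by
  have hd : ∀ t, HasDerivAt (fun s => ψ (γ s)) (fderiv ℝ ψ (γ t) (γ' t)) t := fun t =>
    (hψ.differentiable (by simp) (γ t)).hasFDerivAt.comp_hasDerivAt t (hasDerivAt_pi.2 (hγ t))
  exact convex_univ.norm_image_sub_le_of_norm_hasDerivWithin_le
    (fun t _ => (hd t).hasDerivWithinAt)
    (fun t _ => by rw [fderiv_apply_eq_sum_pd]; exact hC t) (Set.mem_univ s) (Set.mem_univ t)

lemma zPer_of_pd_two_eq_zero (hψ : ContDiff ℝ 1 ψ) (h2 : ∀ x, pd 2 ψ x = 0) : ZPer ψ := by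
  intro x
  have := abs_sub_le_of_curve (C := 0) hψ (γ := fun t => ![x 0, x 1, x 2 + t])
    (γ' := fun _ => ![0, 0, 1]) (fun t i => by
      fin_cases i
      · exact hasDerivAt_const t (x 0)
      · exact hasDerivAt_const t (x 1)
      · exact (hasDerivAt_id t).const_add (x 2)) (fun t => by simp [h2]) 0 1
  have e0 : ![x 0, x 1, x 2 + 0] = x := by ext i; fin_cases i <;> simp
  have e1 : ![x 0, x 1, x 2 + 1] = x + Pi.single 2 1 := by ext i; fin_cases i <;> simp
  rw [e0, e1, zero_mul] at this
  exact sub_eq_zero.1 (abs_nonpos_iff.1 this)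

/-- The stream function oscillates boundedly on horizontal circles. -/
lemma Adm.abs_stream_sub_le (h : Adm M v) (hψ : ContDiff ℝ 1 ψ) (h0 : ∀ x, pd 0 ψ x = vbar v 1 x)
    (h1 : ∀ x, pd 1 ψ x = - vbar v 0 x) (x : V3) : |ψ x - ψ (halfPt x)| ≤ 5 * M := by
  set r := nr x with hr
  have hM := h.nonneg
  have hsq : r ≤ √(1 + rsq x) := Real.sqrt_le_sqrt (by change rsq x ≤ 1 + rsq x; linarith)
  have hsq' : √(1 + rsq x) ≤ r + 1 := by
    rw [Real.sqrt_le_left (by have := Real.sqrt_nonneg (rsq x); rw [hr, nr_eq]; linarith), rsq_eq,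
      ← hr]
    have : 0 ≤ r := Real.sqrt_nonneg _
    nlinarith
  have hline := abs_sub_le_of_curve (C := M) hψ (γ := fun t => ![t, 0, x 2])
    (γ' := fun _ => ![1, 0, 0]) (fun t i => by
      fin_cases i
      · exact hasDerivAt_id t
      · exact hasDerivAt_const t 0
      · exact hasDerivAt_const t (x 2)) (fun t => by
        simpa [h0] using h.abs_vbar_le 1 _) (√(1 + rsq x)) r
  set z : ℂ := ⟨x 0, x 1⟩ with hz
  have hzr : ‖z‖ = r := by rw [Complex.norm_eq_sqrt_sq_add_sq]; rfl
  have hcirc := abs_sub_le_of_curve (C := M) hψ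
    (γ := fun t => ![r * Real.cos t, r * Real.sin t, x 2])
    (γ' := fun t => ![r * -Real.sin t, r * Real.cos t, 0]) (fun t i => by
      fin_cases i
      · exact (Real.hasDerivAt_cos t).const_mul r
      · exact (Real.hasDerivAt_sin t).const_mul r
      · exact hasDerivAt_const t (x 2)) (fun t => by
        have := h.abs_radial_vbar_le ![r * Real.cos t, r * Real.sin t, x 2]
        rw [← abs_neg]
        convert this using 2
        simp [h0, h1]) 0 z.arg
  have ex : ![r * Real.cos z.arg, r * Real.sin z.arg, x 2] = x := by
    rw [← hzr, Complex.norm_mul_cos_arg, Complex.norm_mul_sin_arg]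
    ext i; fin_cases i <;> rfl
  have e0 : ![r * Real.cos 0, r * Real.sin 0, x 2] = ![r, 0, x 2] := by simp
  rw [ex, e0, sub_zero] at hcirc
  have hpi : |z.arg| ≤ 4 := (Complex.abs_arg_le_pi z).trans (by linarith [Real.pi_le_four])
  have hl : |r - √(1 + rsq x)| ≤ 1 := by rw [abs_le]; constructor <;> linarith
  calc |ψ x - ψ (halfPt x)|
      ≤ |ψ x - ψ ![r, 0, x 2]| + |ψ ![r, 0, x 2] - ψ ![√(1 + rsq x), 0, x 2]| := abs_sub_le _ _ _
    _ ≤ M * 4 + M * 1 := by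
        refine add_le_add (hcirc.trans ?_) (hline.trans ?_) <;> gcongr
    _ = 5 * M := by ring

end stream

/-! ### The corrector field -/

/-- A field `Ψ` supported at scale `R` with `div Ψ = v · ∇(cut R)`. -/
structure Corrector (v : V3 → V3) (K R : ℝ) (Ψ : Fin 3 → V3 → ℝ) : Prop where
  smooth : ∀ i, ContDiff ℝ 1 (Ψ i)
  per : ∀ i, ZPer (Ψ i)
  supp : ∀ i, HSupp (Ψ i)
  div : ∀ x, ∑ j, pd j (Ψ j) x = ∑ j, v x j * pd j (cut R) x
  bound : ∀ i x, |Ψ i x| ≤ K / R * eta R x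
  pd_bound : ∀ i j x a, |a * pd j (Ψ i) x|
    ≤ K / R * eta R x * (|a| + a ^ 2 + zAvg (fun _ => 1) (gradSq v) x)

lemma abs_mul_pd_zAvg_id_le {f g : V3 → ℝ} (hf : ContDiff ℝ 1 f) (hg : Continuous g)
    {j : Fin 3} (hfg : ∀ x, pd j f x ^ 2 ≤ g x) (a : ℝ) (x : V3) :
    |a * pd j (zAvg id f) x| ≤ a ^ 2 + zAvg (fun _ => 1) g x := by
  have hgi : IntervalIntegrable (fun s => g (zsh x s)) volume 0 1 :=
    (hg.comp (continuous_const.zsh continuous_id)).intervalIntegrable _ _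
  rw [pd_zAvg continuous_id hf, zAvg, ← intervalIntegral.integral_const_mul]
  have hci : IntervalIntegrable (fun _ : ℝ => a ^ 2) volume 0 1 := intervalIntegrable_const
  have hle : ∀ s ∈ Set.Ioc (0 : ℝ) 1,
      ‖a * (id s * pd j f (zsh x s))‖ ≤ a ^ 2 + g (zsh x s) := fun s hs => by
    have h1 := hfg (zsh x s)
    have h2 : |s| ≤ 1 := by rw [abs_of_pos hs.1]; exact hs.2
    calc ‖a * (id s * pd j f (zsh x s))‖ = |s| * |a * pd j f (zsh x s)| := by
          rw [Real.norm_eq_abs, ← abs_mul]; congr 1; simp only [id]; ring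
      _ ≤ 1 * |a * pd j f (zsh x s)| := by gcongr
      _ ≤ a ^ 2 + pd j f (zsh x s) ^ 2 := by
          rw [one_mul, abs_mul, ← sq_abs a, ← sq_abs (pd j f _)]
          nlinarith [sq_nonneg (|a| - |pd j f (zsh x s)|), sq_nonneg (|a| + |pd j f (zsh x s)|)]
      _ ≤ _ := by gcongr
  refine (intervalIntegral.norm_integral_le_of_norm_le zero_le_one
    (ae_of_all _ hle) (hci.add hgi)).trans_eq ?_
  rw [intervalIntegral.integral_add hci hgi]
  simp [zAvg]

lemma continuous_gradSq_of_adm {M : ℝ} {v : V3 → V3} (h : Adm M v) : Continuous (gradSq v) :=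
  h.contDiff_gradSq.continuous

lemma zAvg_one_nonneg {g : V3 → ℝ} (hg : ∀ x, 0 ≤ g x) (x : V3) : 0 ≤ zAvg (fun _ => 1) g x :=
  intervalIntegral.integral_nonneg zero_le_one fun s _ => by simpa using hg _

lemma pd_two_cut (R : ℝ) : pd 2 (cut R) = fun _ => 0 := by
  ext x; simp [pd_cut, hpos]

lemma pd_pd_cut_comm (R : ℝ) (x : V3) : pd 0 (pd 1 (cut R)) x = pd 1 (pd 0 (cut R)) x := by
  simp only [pd_pd_cut, pd_hpos]
  simp
  ring

lemma pd_two_pd_cut (R : ℝ) (k : Fin 3) (x : V3) : pd 2 (pd k (cut R)) x = 0 := by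
  rw [pd_pd_cut, pd_hpos]
  fin_cases k <;> simp [hpos]

/-- The stream function normalised to be bounded, with bounded gradient. -/
lemma Adm.exists_bounded_stream {M : ℝ} {v : V3 → V3} (h : Adm M v) :
    ∃ q : V3 → ℝ, ContDiff ℝ 1 q ∧ ZPer q ∧ (∀ x, |q x| ≤ 5 * M) ∧
      (∀ j x, |pd j q x| ≤ 5 * M) ∧ ∃ A : V3 → ℝ, ∀ x,
        pd 0 q x = vbar v 1 x - A x * x 0 ∧ pd 1 q x = - vbar v 0 x - A x * x 1 := by
  obtain ⟨ψ, hψ, h0, h1, h2⟩ := h.exists_stream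
  have hc : ContDiff ℝ 1 fun y => ψ (halfPt y) := hψ.comp contDiff_halfPt
  have hp : ∀ j x, pd j (fun y => ψ y - ψ (halfPt y)) x
      = pd j ψ x - hpos j x / √(1 + rsq x) * pd 0 ψ (halfPt x) := fun j x => by
    rw [pd_sub (hψ.differentiable (by simp)) (hc.differentiable (by simp)),
      pd_comp_halfPt hψ h2]
  have hψz := zPer_of_pd_two_eq_zero hψ h2
  have hM := h.nonneg
  refine ⟨fun y => ψ y - ψ (halfPt y), hψ.sub hc, hψz.sub fun x => ?_,
    h.abs_stream_sub_le hψ h0 h1, fun j x => ?_,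
    fun x => pd 0 ψ (halfPt x) / √(1 + rsq x), fun x => ⟨?_, ?_⟩⟩
  · have : halfPt (x + Pi.single 2 1) = halfPt x + Pi.single 2 1 := by
      ext i; fin_cases i <;> simp [halfPt, rsq]
    simp only [this, hψz _]
  · rw [hp]
    have e1 : |pd j ψ x| ≤ M := by
      fin_cases j
      · simpa [h0] using h.abs_vbar_le 1 x
      · simpa [h1] using h.abs_vbar_le 0 x
      · simpa [h2] using hM
    have e2 : |hpos j x / √(1 + rsq x) * pd 0 ψ (halfPt x)| ≤ 1 * M := by
      rw [abs_mul, h0]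
      exact mul_le_mul (abs_hpos_div_le j x) (h.abs_vbar_le 1 _) (abs_nonneg _) zero_le_one
    linarith [abs_sub (pd j ψ x) (hpos j x / √(1 + rsq x) * pd 0 ψ (halfPt x))]
  · rw [hp, h0 x]; simp [hpos]; ring
  · rw [hp, h1 x]; simp [hpos]; ring

lemma Adm.exists_corrector {M : ℝ} {v : V3 → V3} (h : Adm M v) :
    ∃ K, 0 ≤ K ∧ ∀ R ≥ 1, ∃ Ψ, Corrector v K R Ψ := by
  obtain ⟨q, hq, hqz, hqB, hpqB, A, hA⟩ := h.exists_bounded_stream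
  obtain ⟨K, hK0, hK⟩ := exists_bound_pd_cut
  have hM := h.nonneg
  refine ⟨K * (10 * M + 2), by positivity, fun R hR => ?_⟩
  have hRp : 0 < R := by linarith
  set G : Fin 3 → V3 → ℝ := fun k => zAvg id fun x => v x k with hG
  have hGc : ∀ k, ContDiff ℝ 1 (G k) := fun k => contDiff_zAvg continuous_id (h.contDiff_one k)
  have hGz : ∀ k, ZPer (G k) := fun k => (h.per k).zAvg id
  have hGB : ∀ k x, |G k x| ≤ M := fun k x =>
    abs_zAvg_le (fun s hs => by rw [id, abs_of_pos hs.1]; exact hs.2) (fun x => h.bound x k) x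
  have hφ : ∀ k, ContDiff ℝ 1 (pd k (cut R)) := fun k =>
    (contDiff_cut (n := 2) R).pd (by norm_num) k
  have hφz : ∀ k, ZPer (pd k (cut R)) := fun k => (zPer_cut R).pd k
  have hφs : ∀ k, HSupp (pd k (cut R)) := fun k => (hSupp_cut hRp).pd k
  have dq := hq.differentiable (by simp)
  have dG := fun k => (hGc k).differentiable (by simp)
  have dφ := fun k => (hφ k).differentiable (by simp)
  have hqφ : ∀ j k x, pd j (fun y => q y * pd k (cut R) y) x
      = pd j q x * pd k (cut R) x + q x * pd j (pd k (cut R)) x := fun j k x => by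
    rw [pd_mul dq (dφ k)]
  have hGφ : ∀ j x, pd j (fun y => G 0 y * pd 0 (cut R) y + G 1 y * pd 1 (cut R) y) x
      = pd j (G 0) x * pd 0 (cut R) x + G 0 x * pd j (pd 0 (cut R)) x
        + (pd j (G 1) x * pd 1 (cut R) x + G 1 x * pd j (pd 1 (cut R)) x) := fun j x => by
    rw [← pd_mul (dG 0) (dφ 0), ← pd_mul (dG 1) (dφ 1)]
    exact pd_add ((dG 0).mul (dφ 0)) ((dG 1).mul (dφ 1)) x
  set κ : V3 → ℝ := fun x => K / R * eta R x with hκ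
  have hκ0 : ∀ x, 0 ≤ κ x := fun x => mul_nonneg (by positivity) (eta_nonneg hRp x)
  have hφ1 : ∀ k x, |pd k (cut R) x| ≤ κ x := fun k x => (hK R hR x).1 k
  have hφ2 : ∀ l k x, |pd l (pd k (cut R)) x| ≤ κ x := fun l k x => (hK R hR x).2 l k
  have hmul : ∀ {s t S T : ℝ}, |s| ≤ S → |t| ≤ T → |s * t| ≤ S * T := fun hs ht => by
    rw [abs_mul]
    exact mul_le_mul hs ht (abs_nonneg _) ((abs_nonneg _).trans hs)
  have hKκ : ∀ x, K * (10 * M + 2) / R * eta R x = (10 * M + 2) * κ x := fun x => by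
    simp only [hκ]; ring
  have hQ0 := fun x => zAvg_one_nonneg (gradSq_nonneg v) x
  have hqpd : ∀ j k x a, |a * pd j (fun y => q y * pd k (cut R) y) x|
      ≤ (10 * M + 2) * κ x * (|a| + a ^ 2 + zAvg (fun _ => 1) (gradSq v) x) := fun j k x a => by
    have e1 := hmul (le_refl |a|) (hmul (hpqB j x) (hφ1 k x))
    have e2 := hmul (le_refl |a|) (hmul (hqB x) (hφ2 j k x))
    rw [hqφ, mul_add]
    refine (abs_add_le _ _).trans ((add_le_add e1 e2).trans ?_)
    have := hQ0 x
    have := hκ0 x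
    have := abs_nonneg a
    calc |a| * (5 * M * κ x) + |a| * (5 * M * κ x) = 10 * M * κ x * |a| := by ring
      _ ≤ _ := by
        refine mul_le_mul ?_ ?_ (by positivity) (by positivity)
        · nlinarith
        · nlinarith [sq_nonneg a]
  refine ⟨![fun y => q y * pd 1 (cut R) y, fun y => -(q y * pd 0 (cut R) y),
    fun y => G 0 y * pd 0 (cut R) y + G 1 y * pd 1 (cut R) y], ?_, ?_, ?_, ?_, ?_, ?_⟩
  · intro i
    fin_cases i
    · exact hq.mul (hφ 1)
    · exact (hq.mul (hφ 0)).neg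
    · exact ((hGc 0).mul (hφ 0)).add ((hGc 1).mul (hφ 1))
  · intro i
    fin_cases i
    · exact hqz.mul (hφz 1)
    · intro x; exact congrArg Neg.neg ((hqz.mul (hφz 0)) x)
    · exact ((hGz 0).mul (hφz 0)).add ((hGz 1).mul (hφz 1))
  · intro i
    fin_cases i
    · exact (hφs 1).mul_left q
    · obtain ⟨L, hL⟩ := (hφs 0).mul_left q
      exact ⟨L, fun x hx => neg_eq_zero.2 (hL x hx)⟩
    · exact ((hφs 0).mul_left (G 0)).add ((hφs 1).mul_left (G 1))
  · intro x
    simp only [Fin.sum_univ_three, Matrix.cons_val_zero, Matrix.cons_val_one, Matrix.cons_val]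
    rw [pd_neg, hqφ, hqφ, hGφ, pd_two_pd_cut, pd_two_pd_cut, pd_pd_cut_comm, (hA x).1, (hA x).2,
      pd_two_cut]
    simp only [hG]
    rw [pd_two_zAvg_id (h.contDiff_one 0) (h.per 0), pd_two_zAvg_id (h.contDiff_one 1) (h.per 1)]
    have hrot : x 0 * pd 1 (cut R) x = x 1 * pd 0 (cut R) x := by
      simp only [pd_cut, hpos]; simp; ring
    simp only [vbar]
    linear_combination -A x * hrot
  · intro i x
    rw [hKκ]
    have := hκ0 x
    fin_cases i
    · refine (hmul (hqB x) (hφ1 1 x)).trans ?_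
      nlinarith
    · refine (abs_neg _).trans_le ((hmul (hqB x) (hφ1 0 x)).trans ?_)
      nlinarith
    · refine (abs_add_le _ _).trans ((add_le_add (hmul (hGB 0 x) (hφ1 0 x))
        (hmul (hGB 1 x) (hφ1 1 x))).trans ?_)
      nlinarith
  · intro i j x a
    rw [hKκ]
    fin_cases i
    · exact hqpd j 1 x a
    · simp only [Fin.mk_one, Matrix.cons_val_one, Matrix.cons_val_zero, pd_neg, mul_neg, abs_neg]
      exact hqpd j 0 x a
    · have hgj := fun k => abs_mul_pd_zAvg_id_le (h.contDiff_one k)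
        (continuous_gradSq_of_adm h) (j := j) (sq_pd_le_gradSq v k j) a x
      have e := fun k => hmul (hgj k) (hφ1 k x)
      have e' := fun k => hmul (le_refl |a|) (hmul (hGB k x) (hφ2 j k x))
      have hs : |a * pd j (fun y => G 0 y * pd 0 (cut R) y + G 1 y * pd 1 (cut R) y) x|
          ≤ 2 * ((a ^ 2 + zAvg (fun _ => 1) (gradSq v) x) * κ x) + 2 * (|a| * (M * κ x)) := by
        rw [hGφ]
        have t1 := abs_add_le (a * pd j (G 0) x * pd 0 (cut R) x) (a * (G 0 x * pd j (pd 0 (cut R)) x))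
        have t2 := abs_add_le (a * pd j (G 1) x * pd 1 (cut R) x) (a * (G 1 x * pd j (pd 1 (cut R)) x))
        have t3 := abs_add_le (a * pd j (G 0) x * pd 0 (cut R) x + a * (G 0 x * pd j (pd 0 (cut R)) x))
          (a * pd j (G 1) x * pd 1 (cut R) x + a * (G 1 x * pd j (pd 1 (cut R)) x))
        have e0 := e 0
        have e1 := e 1
        have e0' := e' 0
        have e1' := e' 1
        refine le_trans (le_of_eq ?_) (t3.trans (by linarith))
        congr 1
        ring
      refine hs.trans ?_
      have h1 := hQ0 x
      have h2 := hκ0 x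
      have h3 := abs_nonneg a
      have h4 : 0 ≤ M * κ x * (a ^ 2 + zAvg (fun _ => 1) (gradSq v) x) := by positivity
      have h5 : 0 ≤ M * κ x * |a| := by positivity
      have h6 : 0 ≤ κ x * |a| := by positivity
      nlinarith

/-! ### Functions with vanishing integral over the slab -/

lemma integral_eta_le {R : ℝ} (hR : 0 < R) : ∫ x in slab, eta R x ≤ 64 * R ^ 2 := by
  rw [integral_slab_eq_box (L := 4 * R) fun x => eta_eq_zero hR]
  have hc : IntegrableOn (eta R) (box (4 * R)) :=
    (contDiff_eta (n := 1) R).continuous.continuousOn.integrableOn_compact isCompact_Icc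
  calc ∫ x in box (4 * R), eta R x ≤ ∫ _ in box (4 * R), (1 : ℝ) :=
        setIntegral_mono hc (continuous_const.continuousOn.integrableOn_compact isCompact_Icc)
          (eta_le_one R)
    _ = 64 * R ^ 2 := by
        rw [setIntegral_const, volume_real_box (by positivity), smul_eq_mul]; ring

lemma integrableOn_eta {R : ℝ} (hR : 0 < R) : IntegrableOn (eta R) slab :=
  (contDiff_eta (n := 1) R).continuous.integrableOn_slab (hSupp_eta hR)

lemma le_integral_cut {R : ℝ} (hR : 0 < R) : R ^ 2 ≤ ∫ x in slab, cut R x := by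
  have hc : IntegrableOn (cut R) slab :=
    (contDiff_cut (n := 1) R).continuous.integrableOn_slab (hSupp_cut hR)
  have h1 : ∀ x ∈ box (R / 2), cut R x = 1 := fun x hx => by
    obtain ⟨⟨h0, h0'⟩, ⟨h1, h1'⟩, -⟩ := mem_box.1 hx
    refine cut_eq_one hR (Real.sqrt_le_iff.2 ⟨hR.le, ?_⟩)
    nlinarith
  calc R ^ 2 = ∫ _ in box (R / 2), (1 : ℝ) := by
        rw [setIntegral_const, volume_real_box (by positivity), smul_eq_mul]; ring
    _ = ∫ x in box (R / 2), cut R x :=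
        (setIntegral_congr_fun isClosed_Icc.measurableSet fun x hx => h1 x hx).symm
    _ ≤ ∫ x in slab, cut R x :=
        setIntegral_mono_set hc (ae_of_all _ (cut_nonneg R)) (box_subset_slab _).eventuallyLE

/-- Integrable functions with vanishing integral over the slab. -/
def Null (g : V3 → ℝ) : Prop := IntegrableOn g slab ∧ ∫ x in slab, g x = 0

section null
variable {f g : V3 → ℝ}

lemma Null.congr (hf : Null f) (h : ∀ x, f x = g x) : Null g := funext h ▸ hf

lemma Null.add (hf : Null f) (hg : Null g) : Null fun x => f x + g x :=
  ⟨hf.1.add hg.1, by rw [integral_add hf.1 hg.1, hf.2, hg.2, add_zero]⟩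

lemma Null.sub (hf : Null f) (hg : Null g) : Null fun x => f x - g x :=
  ⟨hf.1.sub hg.1, by rw [integral_sub hf.1 hg.1, hf.2, hg.2, sub_zero]⟩

lemma Null.const_mul (c : ℝ) (hf : Null f) : Null fun x => c * f x :=
  ⟨hf.1.const_mul c, by rw [integral_const_mul, hf.2, mul_zero]⟩

lemma Null.sum {F : Fin 3 → V3 → ℝ} (hF : ∀ i, Null (F i)) : Null fun x => ∑ i, F i x := by
  simp only [Fin.sum_univ_three]
  exact ((hF 0).add (hF 1)).add (hF 2)

lemma null_pd (hf : ContDiff ℝ 1 f) (hp : ZPer f) (hs : HSupp f) (i : Fin 3) : Null (pd i f) :=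
  ⟨(hf.pd (m := 0) (by norm_num) i).continuous.integrableOn_slab (hs.pd i),
    integral_slab_pd hf hp hs i⟩

lemma null_div_mul {w : Fin 3 → V3 → ℝ} (hf : ContDiff ℝ 1 f) (hw : ∀ j, ContDiff ℝ 1 (w j))
    (hfp : ZPer f) (hwp : ∀ j, ZPer (w j)) (hs : HSupp f ∨ ∀ j, HSupp (w j)) :
    Null fun x => ∑ j, (pd j f x * w j x + f x * pd j (w j) x) := by
  refine Null.sum fun j => ?_
  have := null_pd (hf.mul (hw j)) (hfp.mul (hwp j))
    (hs.elim (fun h => h.mul_right _) fun h => (h j).mul_left _) j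
  have e : pd j (fun x => f x * w j x) = fun x => pd j f x * w j x + f x * pd j (w j) x := by
    ext x
    rw [pd_mul (hf.differentiable (by simp)) ((hw j).differentiable (by simp))]
  rwa [e] at this

lemma null_grad_mul {w : Fin 3 → V3 → ℝ} (hf : ContDiff ℝ 1 f) (hw : ∀ j, ContDiff ℝ 1 (w j))
    (hfp : ZPer f) (hwp : ∀ j, ZPer (w j)) (hs : ∀ j, HSupp (w j))
    (hd : ∀ x, ∑ j, pd j (w j) x = 0) : Null fun x => ∑ j, pd j f x * w j x := by
  have := null_div_mul hf hw hfp hwp (Or.inr hs)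
  simpa [Finset.sum_add_distrib, ← Finset.mul_sum, hd] using this

end null

/-! ### Periodicity of the pressure -/

/-- Solutions of the Hall-MHD system with admissible velocity and magnetic field. -/
structure Sol (δ M : ℝ) (u b : V3 → V3) (p : V3 → ℝ) : Prop where
  admU : Adm M u
  admB : Adm M b
  smooth_p : ContDiff ℝ (⊤ : ℕ∞) p
  momentum : ∀ x i, (∑ j, u x j * pd j (fun y => u y i) x) + pd i p x
      - (∑ j, b x j * pd j (fun y => b y i) x) - lap (fun y => u y i) x = 0
  magnetic : ∀ x i, (∑ j, u x j * pd j (fun y => b y i) x)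
      - (∑ j, b x j * pd j (fun y => u y i) x) - lap (fun y => b y i) x
      = δ * curl (fun y => cross3 (curl b y) (b y)) x i

lemma ZPer.lap {f : V3 → ℝ} (hf : ZPer f) : ZPer (lap f) := fun x => by
  simp only [_root_.lap]
  exact Finset.sum_congr rfl fun i _ => (hf.pd i).pd i x

lemma contDiff_shift {p : V3 → ℝ} {n : WithTop ℕ∞} (hp : ContDiff ℝ n p) (e : V3) :
    ContDiff ℝ n fun x => p (x + e) := hp.comp (contDiff_id.add contDiff_const)

lemma pd_shift (p : V3 → ℝ) (e : V3) (i : Fin 3) (x : V3) :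
    pd i (fun y => p (y + e)) x = pd i p (x + e) := by
  simp only [pd, fderiv_comp_add_right]

section pressure
variable {δ M : ℝ} {u b : V3 → V3} {p : V3 → ℝ}

lemma Sol.zPer_pd_pressure (h : Sol δ M u b p) (i : Fin 3) : ZPer (pd i p) := by
  have e : pd i p = fun x => lap (fun y => u y i) x - (∑ j, u x j * pd j (fun y => u y i) x)
      + ∑ j, b x j * pd j (fun y => b y i) x := by
    ext x; linear_combination h.momentum x i
  intro x
  rw [e]
  simp only [(h.admU.per i).lap x]
  have hx : ∀ {v : V3 → V3}, Adm M v → ∀ j, v (x + Pi.single 2 1) j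
      * pd j (fun y => v y i) (x + Pi.single 2 1) = v x j * pd j (fun y => v y i) x :=
    fun hv j => ((hv.per j).mul ((hv.per i).pd j)) x
  simp only [hx h.admU, hx h.admB]

lemma Sol.exists_pressure_jump (h : Sol δ M u b p) :
    ∃ c, ∀ x, p (x + Pi.single 2 1) = p x + c := by
  have hd : Differentiable ℝ p := h.smooth_p.differentiable (by simp)
  have hd' : Differentiable ℝ fun x : V3 => p (x + Pi.single 2 1) :=
    (contDiff_shift h.smooth_p (Pi.single 2 1)).differentiable (by simp)
  have h0 : ∀ x, fderiv ℝ (fun x : V3 => p (x + Pi.single 2 1) - p x) x = 0 := fun x => by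
    ext w
    rw [fderiv_apply_eq_sum_pd]
    simp only [pd_sub hd' hd, pd_shift, h.zPer_pd_pressure _ x]
    simp
  refine ⟨p (0 + Pi.single 2 1) - p 0, fun x => ?_⟩
  have := is_const_of_fderiv_eq_zero (hd'.sub hd) h0 x 0
  simp only [Pi.sub_apply] at this
  linarith

/-- Testing the vertical momentum equation with a cut-off function. -/
lemma Sol.null_pressure_jump (h : Sol δ M u b p) {c : ℝ}
    (hc : ∀ x, p (x + Pi.single 2 1) = p x + c) {R : ℝ} (hR : 0 < R) :
    Null fun x => c * cut R x - (u x 2 * (∑ j, pd j (pd j (cut R)) x)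
      + u x 2 * (∑ j, u x j * pd j (cut R) x) - b x 2 * (∑ j, b x j * pd j (cut R) x)) := by
  have hφ : ContDiff ℝ 1 (cut R) := contDiff_cut (n := 1) R
  have dφ := hφ.differentiable (by simp)
  have hφ' : ∀ k, ContDiff ℝ 1 (pd k (cut R)) := fun k =>
    (contDiff_cut (n := 2) R).pd (by norm_num) k
  have hφs := hSupp_cut hR
  have hφz := zPer_cut R
  have du := fun i => (h.admU.contDiff_one i).differentiable (by simp)
  have db := fun i => (h.admB.contDiff_one i).differentiable (by simp)
  have hp1 : ContDiff ℝ 1 p := h.smooth_p.of_le (by exact_mod_cast le_top)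
  have hx2 : ContDiff ℝ 1 fun x : V3 => x 2 := contDiff_apply ℝ ℝ (2 : Fin 3)
  have n1 := null_div_mul hφ (h.admU.contDiff_pd 2) hφz (fun j => (h.admU.per 2).pd j) (Or.inl hφs)
  have n2 := null_div_mul (h.admU.contDiff_one 2) hφ' (h.admU.per 2) (fun j => hφz.pd j)
    (Or.inr fun j => hφs.pd j)
  have n3 := null_div_mul ((h.admU.contDiff_one 2).mul hφ) h.admU.contDiff_one
    ((h.admU.per 2).mul hφz) h.admU.per (Or.inl (hφs.mul_left _))
  have n4 := null_div_mul ((h.admB.contDiff_one 2).mul hφ) h.admB.contDiff_one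
    ((h.admB.per 2).mul hφz) h.admB.per (Or.inl (hφs.mul_left _))
  have hq : ContDiff ℝ 1 fun x => p x - c * x 2 := hp1.sub (contDiff_const.mul hx2)
  have hqz : ZPer fun x => p x - c * x 2 := fun x => by simp [hc]; ring
  have n5 := null_pd (hφ.mul hq) (hφz.mul hqz) (hφs.mul_right _) 2
  have e := ((n1.sub n2).sub (n3.sub n4)).sub n5
  have hpd : ∀ x, pd 2 (fun x => cut R x * (p x - c * x 2)) x = cut R x * (pd 2 p x - c) := by
    intro x
    rw [pd_mul dφ (hq.differentiable (by simp)), pd_two_cut,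
      pd_sub (hp1.differentiable (by simp)) ((hx2.differentiable (by simp)).const_mul c),
      pd_const_mul c (hx2.differentiable (by simp)), pd_coord]
    simp
  refine e.congr fun x => ?_
  have hm := h.momentum x 2
  have hu := h.admU.div x
  have hb := h.admB.div x
  simp only [lap, Fin.sum_univ_three] at hm hu hb ⊢
  simp only [hpd, pd_mul (du 2) dφ, pd_mul (db 2) dφ]
  linear_combination -cut R x * hm - u x 2 * cut R x * hu + b x 2 * cut R x * hb

lemma Sol.zPer_pressure (h : Sol δ M u b p) : ZPer p := by
  obtain ⟨c, hc⟩ := h.exists_pressure_jump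
  obtain ⟨K, hK0, hK⟩ := exists_bound_pd_cut
  have hM := h.admU.nonneg
  set B : ℝ := 3 * M + 6 * M ^ 2 with hB
  have hB0 : 0 ≤ B := by positivity
  have hle : ∀ R ≥ 1, |c| * R ≤ 64 * (B * K) := fun R hR => by
    have hRp : 0 < R := by linarith
    have hn := h.null_pressure_jump hc hRp
    have hcut : IntegrableOn (fun x => c * cut R x) slab :=
      ((contDiff_cut (n := 1) R).continuous.integrableOn_slab (hSupp_cut hRp)).const_mul c
    set g : V3 → ℝ := fun x => u x 2 * (∑ j, pd j (pd j (cut R)) x)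
      + u x 2 * (∑ j, u x j * pd j (cut R) x) - b x 2 * (∑ j, b x j * pd j (cut R) x) with hg
    have hgi : IntegrableOn g slab := by
      have := hcut.sub hn.1
      simpa [Pi.sub_def] using this
    have heq : c * ∫ x in slab, cut R x = ∫ x in slab, g x := by
      have := hn.2
      rw [integral_sub hcut hgi, integral_const_mul] at this
      linarith
    have hgb : ∀ x, |g x| ≤ B * (K / R) * eta R x := fun x => by
      obtain ⟨h1, h2⟩ := hK R hR x
      set κ := K / R * eta R x with hκ
      have hsum : ∀ {t : Fin 3 → ℝ} {T : ℝ}, (∀ j, |t j| ≤ T) → |∑ j, t j| ≤ 3 * T :=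
        fun {t T} ht => (Finset.abs_sum_le_sum_abs _ _).trans
          ((Finset.sum_le_sum fun j _ => ht j).trans_eq (by simp))
      have hmul : ∀ {s t S T : ℝ}, |s| ≤ S → |t| ≤ T → |s * t| ≤ S * T := fun hs ht => by
        rw [abs_mul]
        exact mul_le_mul hs ht (abs_nonneg _) ((abs_nonneg _).trans hs)
      have t1 := hmul (h.admU.bound x 2) (hsum fun j => h2 j j)
      have t2 := hmul (h.admU.bound x 2) (hsum fun j => hmul (h.admU.bound x j) (h1 j))
      have t3 := hmul (h.admB.bound x 2) (hsum fun j => hmul (h.admB.bound x j) (h1 j))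
      refine ((abs_sub _ _).trans (add_le_add ((abs_add_le _ _).trans (add_le_add t1 t2)) t3)).trans
        (le_of_eq ?_)
      rw [hB, hκ]; ring
    have h1 : |∫ x in slab, g x| ≤ B * (K / R) * (64 * R ^ 2) := by
      refine (norm_integral_le_of_norm_le (f := g) ((integrableOn_eta hRp).const_mul (B * (K / R)))
        (ae_of_all _ hgb)).trans ?_
      rw [integral_const_mul]
      exact mul_le_mul_of_nonneg_left (integral_eta_le hRp) (by positivity)
    rw [← heq, abs_mul] at h1
    have h2 : |c| * R ^ 2 ≤ B * (K / R) * (64 * R ^ 2) :=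
      (mul_le_mul_of_nonneg_left ((le_integral_cut hRp).trans (le_abs_self _))
        (abs_nonneg c)).trans h1
    have h3 : B * (K / R) * (64 * R ^ 2) = 64 * (B * K) * R := by field_simp
    rw [h3] at h2
    nlinarith
  have hc0 : c = 0 := by
    by_contra hne
    have hpos := abs_pos.2 hne
    have := hle (64 * (B * K) / |c| + 1) (by have : 0 ≤ 64 * (B * K) / |c| := by positivity
                                             linarith)
    rw [mul_add, mul_div_cancel₀ _ hpos.ne'] at this
    linarith
  intro x
  rw [hc, hc0, add_zero]

end pressure

/-! ### The energy identity -/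

lemma null_curl {F G : V3 → V3} (hF : ∀ i, ContDiff ℝ 1 fun x => F x i)
    (hG : ∀ i, ContDiff ℝ 1 fun x => G x i) (hFz : ∀ i, ZPer fun x => F x i)
    (hGz : ∀ i, ZPer fun x => G x i) (hGs : ∀ i, HSupp fun x => G x i) :
    Null fun x => dot3 (G x) (curl F x) - dot3 (F x) (curl G x) := by
  have dF := fun i => (hF i).differentiable (by simp)
  have dG := fun i => (hG i).differentiable (by simp)
  have hn : ∀ k i j, Null (pd k fun x => F x i * G x j - F x j * G x i) := fun k i j =>
    null_pd (((hF i).mul (hG j)).sub ((hF j).mul (hG i)))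
      (((hFz i).mul (hGz j)).sub ((hFz j).mul (hGz i)))
      (((hGs j).mul_left _).sub ((hGs i).mul_left _)) k
  refine (((hn 0 1 2).add (hn 1 2 0)).add (hn 2 0 1)).congr fun x => ?_
  have e : ∀ k i j, pd k (fun x => F x i * G x j - F x j * G x i) x
      = pd k (fun x => F x i) x * G x j + F x i * pd k (fun x => G x j) x
        - (pd k (fun x => F x j) x * G x i + F x j * pd k (fun x => G x i) x) := fun k i j => by
    rw [← pd_mul (dF i) (dG j), ← pd_mul (dF j) (dG i)]
    exact pd_sub ((dF i).mul (dG j)) ((dF j).mul (dG i)) x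
  simp only [e, dot3, curl, Fin.sum_univ_three, Matrix.cons_val]
  ring

/-- The error terms in the local energy identity. -/
def energyError (δ R : ℝ) (u b : V3 → V3) (Ψ Θ : Fin 3 → V3 → ℝ) (x : V3) : ℝ :=
  (∑ i, ∑ j, pd j (fun y => u y i) x * pd j (Ψ i) x)
  + (∑ i, ∑ j, pd j (fun y => u y i) x
      * (Ψ i x * u x j - u x i * Ψ j x - u x i * pd j (cut R) x + b x i * Θ j x))
  + (∑ i, ∑ j, pd j (fun y => b y i) x
      * (u x i * Θ j x - Ψ i x * b x j - b x i * Ψ j x - b x i * pd j (cut R) x))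
  + δ * dot3 (cross3 (curl b x) (b x)) (cross3 (fun k => pd k (cut R) x) (b x))

section energy
variable {δ M K K' R : ℝ} {u b v : V3 → V3} {p : V3 → ℝ} {Ψ Θ : Fin 3 → V3 → ℝ}

lemma Corrector.div_cut_sub (hv : Adm M v) (hΨ : Corrector v K R Ψ) (x : V3) :
    ∑ j, pd j (fun y => cut R y * v y j - Ψ j y) x = 0 := by
  have dφ := (contDiff_cut (n := 1) R).differentiable (by simp)
  have dv := fun i => (hv.contDiff_one i).differentiable (by simp)
  have dΨ := fun i => (hΨ.smooth i).differentiable (by simp)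
  have h1 := hΨ.div x
  have h2 := hv.div x
  have e : ∀ j, pd j (fun y => cut R y * v y j - Ψ j y) x
      = pd j (cut R) x * v x j + cut R x * pd j (fun y => v y j) x - pd j (Ψ j) x := fun j => by
    rw [← pd_mul dφ (dv j)]
    exact pd_sub (dφ.mul (dv j)) (dΨ j) x
  simp only [e, Fin.sum_univ_three] at *
  linear_combination cut R x * h2 - h1

lemma Adm.contDiff_hall (hb : Adm M b) (i : Fin 3) :
    ContDiff ℝ 1 fun x => cross3 (curl b x) (b x) i := by
  have h1 := hb.contDiff_one
  have h2 := hb.contDiff_pd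
  fin_cases i
  · exact (((h2 0 2).sub (h2 2 0)).mul (h1 2)).sub (((h2 1 0).sub (h2 0 1)).mul (h1 1))
  · exact (((h2 1 0).sub (h2 0 1)).mul (h1 0)).sub (((h2 2 1).sub (h2 1 2)).mul (h1 2))
  · exact (((h2 2 1).sub (h2 1 2)).mul (h1 1)).sub (((h2 0 2).sub (h2 2 0)).mul (h1 0))

lemma Adm.zPer_hall (hb : Adm M b) (i : Fin 3) : ZPer fun x => cross3 (curl b x) (b x) i := by
  intro x
  have h1 := fun i => hb.per i x
  have h2 := fun i j => (hb.per i).pd j x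
  simp only [cross3, curl, h1, h2]

lemma Sol.null_hall (h : Sol δ M u b p) (hR : 0 < R) :
    Null fun x => cut R x * dot3 (b x) (curl (fun y => cross3 (curl b y) (b y)) x)
      - dot3 (cross3 (curl b x) (b x)) (cross3 (fun k => pd k (cut R) x) (b x)) := by
  have hφ : ContDiff ℝ 1 (cut R) := contDiff_cut (n := 1) R
  have dφ := hφ.differentiable (by simp)
  have db := fun i => (h.admB.contDiff_one i).differentiable (by simp)
  refine (null_curl (G := fun x i => cut R x * b x i) h.admB.contDiff_hall
    (fun i => hφ.mul (h.admB.contDiff_one i)) h.admB.zPer_hall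
    (fun i => (zPer_cut R).mul (h.admB.per i)) fun i => (hSupp_cut hR).mul_right _).congr
    fun x => ?_
  have e : curl (fun x i => cut R x * b x i) x
      = fun i => cross3 (fun k => pd k (cut R) x) (b x) i + cut R x * curl b x i := by
    ext i
    fin_cases i <;> simp [curl, cross3, pd_mul dφ (db _)] <;> ring
  rw [e]
  generalize curl (fun y => cross3 (curl b y) (b y)) x = c
  generalize curl b x = J
  simp only [dot3, cross3, Fin.sum_univ_three, Matrix.cons_val]
  ring

lemma Sol.null_energy (h : Sol δ M u b p) (hR : 0 < R) (hΨ : Corrector u K R Ψ)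
    (hΘ : Corrector b K' R Θ) :
    Null fun x => cut R x * (gradSq u x + gradSq b x) - energyError δ R u b Ψ Θ x := by
  have hφ : ContDiff ℝ 1 (cut R) := contDiff_cut (n := 1) R
  have dφ := hφ.differentiable (by simp)
  have hφs := hSupp_cut hR
  have hφz := zPer_cut R
  have cu := h.admU.contDiff_one
  have cb := h.admB.contDiff_one
  have du := fun i => (cu i).differentiable (by simp)
  have db := fun i => (cb i).differentiable (by simp)
  have dΨ := fun i => (hΨ.smooth i).differentiable (by simp)
  have hp1 : ContDiff ℝ 1 p := h.smooth_p.of_le (by exact_mod_cast le_top)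
  have cW : ∀ i, ContDiff ℝ 1 fun x => cut R x * u x i - Ψ i x := fun i =>
    (hφ.mul (cu i)).sub (hΨ.smooth i)
  have zW : ∀ i, ZPer fun x => cut R x * u x i - Ψ i x := fun i =>
    (hφz.mul (h.admU.per i)).sub (hΨ.per i)
  have sW : ∀ i, HSupp fun x => cut R x * u x i - Ψ i x := fun i =>
    (hφs.mul_right _).sub (hΨ.supp i)
  have n1 := Null.sum fun i => null_div_mul (cW i) (h.admU.contDiff_pd i) (zW i)
    (fun j => (h.admU.per i).pd j) (Or.inl (sW i))
  have n2 := Null.sum fun i => null_div_mul (hφ.mul (cb i)) (h.admB.contDiff_pd i)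
    (hφz.mul (h.admB.per i)) (fun j => (h.admB.per i).pd j) (Or.inl (hφs.mul_right _))
  have n3 := null_grad_mul hp1 cW h.zPer_pressure zW sW (hΨ.div_cut_sub h.admU)
  have n4 := fun i => null_grad_mul ((cu i).mul (cu i)) cW ((h.admU.per i).mul (h.admU.per i))
    zW sW (hΨ.div_cut_sub h.admU)
  have n4' := fun i => null_grad_mul ((cb i).mul (cb i)) cW ((h.admB.per i).mul (h.admB.per i))
    zW sW (hΨ.div_cut_sub h.admU)
  have n5 := fun i => null_grad_mul ((cu i).mul (cb i)) (fun j => (hφ.mul (cb j)).sub (hΘ.smooth j))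
    ((h.admU.per i).mul (h.admB.per i)) (fun j => (hφz.mul (h.admB.per j)).sub (hΘ.per j))
    (fun j => (hφs.mul_right _).sub (hΘ.supp j)) (hΘ.div_cut_sub h.admB)
  have n6 := h.null_hall hR
  have e := ((((n1.add n2).sub n3).sub
    ((Null.sum fun i => (n4 i).add (n4' i)).const_mul (1 / 2))).add (Null.sum n5)).add
    (n6.const_mul δ)
  refine e.congr fun x => ?_
  have eW : ∀ i j, pd j (fun y => cut R y * u y i - Ψ i y) x
      = pd j (cut R) x * u x i + cut R x * pd j (fun y => u y i) x - pd j (Ψ i) x := fun i j => by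
    rw [← pd_mul dφ (du i)]
    exact pd_sub (dφ.mul (du i)) (dΨ i) x
  have hm := h.momentum x
  have hi := h.magnetic x
  simp only [eW, pd_mul dφ (db _), pd_mul (du _) (du _), pd_mul (du _) (db _),
    pd_mul (db _) (db _)]
  unfold energyError
  generalize dot3 (cross3 (curl b x) (b x)) (cross3 (fun k => pd k (cut R) x) (b x)) = H
  simp only [lap, dot3, gradSq, Fin.sum_univ_three] at hm hi ⊢
  generalize curl (fun y => cross3 (curl b y) (b y)) x = c at hi ⊢
  linear_combination -(cut R x * u x 0 - Ψ 0 x) * hm 0 - (cut R x * u x 1 - Ψ 1 x) * hm 1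
    - (cut R x * u x 2 - Ψ 2 x) * hm 2 - cut R x * (b x 0 * hi 0 + b x 1 * hi 1 + b x 2 * hi 2)

end energy

/-! ### The energy estimate -/

/-- The local Dirichlet energy. -/
def energy (u b : V3 → V3) (R : ℝ) : ℝ := ∫ x in slab, cut R x * (gradSq u x + gradSq b x)

lemma abs_sum_sum_le {t : Fin 3 → Fin 3 → ℝ} {T : ℝ} (h : ∀ i j, |t i j| ≤ T) :
    |∑ i, ∑ j, t i j| ≤ 9 * T :=
  calc |∑ i, ∑ j, t i j| ≤ ∑ i, ∑ j, |t i j| :=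
        (Finset.abs_sum_le_sum_abs _ _).trans
          (Finset.sum_le_sum fun i _ => Finset.abs_sum_le_sum_abs _ _)
    _ ≤ ∑ _ : Fin 3, ∑ _ : Fin 3, T :=
        Finset.sum_le_sum fun i _ => Finset.sum_le_sum fun j _ => h i j
    _ = 9 * T := by simp; ring

lemma abs_mul_le_mul {s t S T : ℝ} (hs : |s| ≤ S) (ht : |t| ≤ T) : |s * t| ≤ S * T := by
  rw [abs_mul]
  exact mul_le_mul hs ht (abs_nonneg _) ((abs_nonneg _).trans hs)

lemma abs_cross3_le {a c : V3} {A C : ℝ} (ha : ∀ i, |a i| ≤ A) (hc : ∀ i, |c i| ≤ C) (i : Fin 3) :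
    |cross3 a c i| ≤ 2 * (A * C) := by
  have h : ∀ j k l m, |a j * c k - a l * c m| ≤ 2 * (A * C) := fun j k l m => by
    have h1 := abs_mul_le_mul (ha j) (hc k)
    have h2 := abs_mul_le_mul (ha l) (hc m)
    linarith [abs_sub (a j * c k) (a l * c m)]
  fin_cases i <;> exact h _ _ _ _

lemma abs_dot3_le {a c : V3} {A C : ℝ} (ha : ∀ i, |a i| ≤ A) (hc : ∀ i, |c i| ≤ C) :
    |dot3 a c| ≤ 3 * (A * C) :=
  (Finset.abs_sum_le_sum_abs _ _).trans
    ((Finset.sum_le_sum fun i _ => abs_mul_le_mul (ha i) (hc i)).trans_eq (by simp))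

lemma abs_curl_le {b : V3 → V3} {x : V3} {s : ℝ} (h : ∀ i j, |pd j (fun y => b y i) x| ≤ s)
    (i : Fin 3) : |curl b x i| ≤ 2 * s := by
  have h' : ∀ j k l m, |pd j (fun y => b y k) x - pd l (fun y => b y m) x| ≤ 2 * s :=
    fun j k l m => by
      linarith [abs_sub (pd j (fun y => b y k) x) (pd l (fun y => b y m) x), h k j, h m l]
  fin_cases i <;> exact h' _ _ _ _

section estimate
variable {δ M R : ℝ} {u b : V3 → V3} {p : V3 → ℝ} {Ψ Θ : Fin 3 → V3 → ℝ}

lemma abs_energyError_le (hδ : δ ∈ Set.Icc (0 : ℝ) 1) {x : V3} {κ s A : ℝ}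
    (hA : 0 ≤ A) (hu : ∀ i, |u x i| ≤ M) (hb : ∀ i, |b x i| ≤ M)
    (hdu : ∀ i j, |pd j (fun y => u y i) x| ≤ s) (hdb : ∀ i j, |pd j (fun y => b y i) x| ≤ s)
    (hφ : ∀ k, |pd k (cut R) x| ≤ κ) (hΨ : ∀ i, |Ψ i x| ≤ κ) (hΘ : ∀ i, |Θ i x| ≤ κ)
    (hdΨ : ∀ i j a, |a * pd j (Ψ i) x| ≤ κ * (|a| + a ^ 2 + A)) :
    |energyError δ R u b Ψ Θ x| ≤ (9 + 72 * M + 24 * M ^ 2) * (κ * (s + s ^ 2 + A)) := by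
  have hM : 0 ≤ M := (abs_nonneg _).trans (hu 0)
  have hs : 0 ≤ s := (abs_nonneg _).trans (hdu 0 0)
  have hκ : 0 ≤ κ := (abs_nonneg _).trans (hφ 0)
  have t1 := abs_sum_sum_le fun i j => (hdΨ i j (pd j (fun y => u y i) x)).trans
    (mul_le_mul_of_nonneg_left (add_le_add (add_le_add (hdu i j)
      (sq_le_sq' (neg_le_of_abs_le (hdu i j)) (le_of_abs_le (hdu i j)))) le_rfl) hκ)
  have t2 := abs_sum_sum_le fun i j => abs_mul_le_mul (hdu i j)
    (show |Ψ i x * u x j - u x i * Ψ j x - u x i * pd j (cut R) x + b x i * Θ j x|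
      ≤ 4 * (M * κ) by
      have e1 := abs_mul_le_mul (hu j) (hΨ i)
      rw [mul_comm] at e1
      have e2 := abs_mul_le_mul (hu i) (hΨ j)
      have e3 := abs_mul_le_mul (hu i) (hφ j)
      have e4 := abs_mul_le_mul (hb i) (hΘ j)
      simp only [abs_le] at *
      constructor <;> linarith)
  have t3 := abs_sum_sum_le fun i j => abs_mul_le_mul (hdb i j)
    (show |u x i * Θ j x - Ψ i x * b x j - b x i * Ψ j x - b x i * pd j (cut R) x|
      ≤ 4 * (M * κ) by
      have e1 := abs_mul_le_mul (hb j) (hΨ i)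
      rw [mul_comm] at e1
      have e2 := abs_mul_le_mul (hb i) (hΨ j)
      have e3 := abs_mul_le_mul (hb i) (hφ j)
      have e4 := abs_mul_le_mul (hu i) (hΘ j)
      simp only [abs_le] at *
      constructor <;> linarith)
  have t4 := abs_mul_le_mul (show |δ| ≤ 1 by rw [abs_of_nonneg hδ.1]; exact hδ.2)
    (abs_dot3_le (abs_cross3_le (abs_curl_le hdb) hb) (abs_cross3_le (a := fun k => pd k (cut R) x) hφ hb))
  have h1 : 0 ≤ κ * s := by positivity
  have h2 : 0 ≤ κ * (s ^ 2 + A) := by positivity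
  have h3 : 0 ≤ M * (κ * (s ^ 2 + A)) := by positivity
  have h4 : 0 ≤ M ^ 2 * (κ * (s ^ 2 + A)) := by positivity
  unfold energyError
  refine (abs_add_le _ _).trans ((add_le_add ((abs_add_le _ _).trans (add_le_add
    ((abs_add_le _ _).trans (add_le_add t1 t2)) t3)) t4).trans ?_)
  linarith

lemma Adm.integrableOn_cut_mul (hu : Adm M u) (hb : Adm M b) (hR : 0 < R) :
    IntegrableOn (fun x => cut R x * (gradSq u x + gradSq b x)) slab :=
  ((contDiff_cut (n := 1) R).continuous.mul (hu.contDiff_gradSq.continuous.add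
    hb.contDiff_gradSq.continuous)).integrableOn_slab ((hSupp_cut hR).mul_right _)

lemma Adm.integrableOn_eta_mul (hu : Adm M u) (hb : Adm M b) (hR : 0 < R) :
    IntegrableOn (fun x => eta R x * (gradSq u x + gradSq b x)) slab :=
  ((contDiff_eta (n := 1) R).continuous.mul (hu.contDiff_gradSq.continuous.add
    hb.contDiff_gradSq.continuous)).integrableOn_slab ((hSupp_eta hR).mul_right _)

lemma Adm.integral_eta_mul (hu : Adm M u) (hb : Adm M b) (hR : 0 < R) :
    ∫ x in slab, eta R x * (gradSq u x + gradSq b x) = energy u b (2 * R) - energy u b (R / 2) := by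
  rw [energy, energy, ← integral_sub (hu.integrableOn_cut_mul hb (by positivity))
    (hu.integrableOn_cut_mul hb (by positivity))]
  simp only [eta, sub_mul]

lemma Sol.energy_le (h : Sol δ M u b p) (hδ : δ ∈ Set.Icc (0 : ℝ) 1) :
    ∃ C, 0 ≤ C ∧ ∀ R ≥ 1, ∀ ε > 0, energy u b R
      ≤ C * (ε * (energy u b (2 * R) - energy u b (R / 2)) + 1 / ε
        + (energy u b (2 * R) - energy u b (R / 2)) / R) := by
  obtain ⟨K₀, hK₀, hφ⟩ := exists_bound_pd_cut
  obtain ⟨K₁, hK₁, hu⟩ := h.admU.exists_corrector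
  obtain ⟨K₂, hK₂, hb⟩ := h.admB.exists_corrector
  have hM := h.admU.nonneg
  set B : ℝ := (9 + 72 * M + 24 * M ^ 2) * (K₀ + K₁ + K₂) with hB
  have hB0 : 0 ≤ B := by positivity
  refine ⟨64 * B, by positivity, fun R hR ε hε => ?_⟩
  have hRp : 0 < R := by linarith
  obtain ⟨Ψ, hΨ⟩ := hu R hR
  obtain ⟨Θ, hΘ⟩ := hb R hR
  set Q : V3 → ℝ := fun x => gradSq u x + gradSq b x with hQ
  set A : V3 → ℝ := zAvg (fun _ => 1) (gradSq u) with hA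
  have hA0 : ∀ x, 0 ≤ A x := zAvg_one_nonneg (gradSq_nonneg u)
  have hQ0 : ∀ x, 0 ≤ Q x := fun x => add_nonneg (gradSq_nonneg u x) (gradSq_nonneg b x)
  have hpt : ∀ x, energyError δ R u b Ψ Θ x
      ≤ B * (ε * (eta R x * Q x) + 1 / (ε * R ^ 2) * eta R x + 1 / R * (eta R x * Q x)
        + 1 / R * (eta R x * A x)) := fun x => by
    have hη := eta_nonneg hRp x
    set s := √(Q x) with hs
    have hs2 : s ^ 2 = Q x := Real.sq_sqrt (hQ0 x)
    set κ := (K₀ + K₁ + K₂) / R * eta R x with hκ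
    have hle : ∀ {K}, K ≤ K₀ + K₁ + K₂ → K / R * eta R x ≤ κ := fun hK =>
      mul_le_mul_of_nonneg_right (div_le_div_of_nonneg_right hK hRp.le) hη
    have l0 := hle (K := K₀) (by linarith)
    have l1 := hle (K := K₁) (by linarith)
    have l2 := hle (K := K₂) (by linarith)
    have e := abs_energyError_le (R := R) (Ψ := Ψ) (Θ := Θ) (κ := κ) (s := s) hδ (hA0 x)
      (h.admU.bound x) (h.admB.bound x)
      (fun i j => Real.abs_le_sqrt ((sq_pd_le_gradSq u i j x).trans
        (le_add_of_nonneg_right (gradSq_nonneg b x))))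
      (fun i j => Real.abs_le_sqrt ((sq_pd_le_gradSq b i j x).trans
        (le_add_of_nonneg_left (gradSq_nonneg u x))))
      (fun k => ((hφ R hR x).1 k).trans l0) (fun i => (hΨ.bound i x).trans l1)
      (fun i => (hΘ.bound i x).trans l2)
      (fun i j a => (hΨ.pd_bound i j x a).trans (mul_le_mul_of_nonneg_right l1
        (by have := hA0 x; positivity)))
    have hy : s / R ≤ ε * s ^ 2 + 1 / (ε * R ^ 2) := by
      have e1 : ε * s ^ 2 + 1 / (ε * R ^ 2) - s / R
          = ε * ((s - 1 / (2 * (ε * R))) ^ 2 + 3 / 4 * (1 / (ε * R)) ^ 2) := by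
        field_simp; ring
      have : 0 ≤ ε * ((s - 1 / (2 * (ε * R))) ^ 2 + 3 / 4 * (1 / (ε * R)) ^ 2) := by positivity
      linarith
    refine (le_abs_self _).trans (e.trans ?_)
    calc (9 + 72 * M + 24 * M ^ 2) * (κ * (s + s ^ 2 + A x))
        = B * eta R x * (s / R + 1 / R * s ^ 2 + 1 / R * A x) := by rw [hκ, hB]; ring
      _ ≤ B * eta R x * (ε * s ^ 2 + 1 / (ε * R ^ 2) + 1 / R * s ^ 2 + 1 / R * A x) := by gcongr
      _ = _ := by rw [hs2]; ring
  have hn := h.null_energy hRp hΨ hΘ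
  have hQi := h.admU.integrableOn_cut_mul h.admB hRp
  have hEi : IntegrableOn (energyError δ R u b Ψ Θ) slab := by
    simpa [Pi.sub_def] using hQi.sub hn.1
  have hE : energy u b R = ∫ x in slab, energyError δ R u b Ψ Θ x := by
    have := hn.2
    rw [integral_sub hQi hEi] at this
    exact sub_eq_zero.1 this
  have i1 : IntegrableOn (fun x => eta R x * Q x) slab := h.admU.integrableOn_eta_mul h.admB hRp
  have i2 := integrableOn_eta hRp
  have i3 : IntegrableOn (fun x => eta R x * A x) slab :=
    ((contDiff_eta (n := 1) R).continuous.mul (continuous_zAvg continuous_const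
      h.admU.contDiff_gradSq.continuous)).integrableOn_slab ((hSupp_eta hRp).mul_right _)
  have i4 : IntegrableOn (fun x => eta R x * gradSq u x) slab :=
    ((contDiff_eta (n := 1) R).continuous.mul
      h.admU.contDiff_gradSq.continuous).integrableOn_slab ((hSupp_eta hRp).mul_right _)
  have hD := h.admU.integral_eta_mul h.admB hRp
  set D := energy u b (2 * R) - energy u b (R / 2) with hDdef
  have hAD : ∫ x in slab, eta R x * A x ≤ D := by
    rw [hA, integral_slab_mul_zAvg (contDiff_eta (n := 1) R) h.admU.contDiff_gradSq (eta_zsh R)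
      (hSupp_eta hRp) h.admU.zPer_gradSq, ← hD]
    exact setIntegral_mono i4 i1 fun x => mul_le_mul_of_nonneg_left
      (le_add_of_nonneg_right (gradSq_nonneg b x)) (eta_nonneg hRp x)
  have hD0 : 0 ≤ D := hD ▸ integral_nonneg fun x => mul_nonneg (eta_nonneg hRp x) (hQ0 x)
  have j1 : IntegrableOn (fun x => ε * (eta R x * Q x) + 1 / (ε * R ^ 2) * eta R x) slab :=
    (i1.const_mul _).add (i2.const_mul _)
  have j2 : IntegrableOn (fun x => ε * (eta R x * Q x) + 1 / (ε * R ^ 2) * eta R x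
      + 1 / R * (eta R x * Q x)) slab := j1.add (i1.const_mul _)
  have j3 : IntegrableOn (fun x => ε * (eta R x * Q x) + 1 / (ε * R ^ 2) * eta R x
      + 1 / R * (eta R x * Q x) + 1 / R * (eta R x * A x)) slab := j2.add (i3.const_mul _)
  rw [hE]
  calc ∫ x in slab, energyError δ R u b Ψ Θ x
      ≤ ∫ x in slab, B * (ε * (eta R x * Q x) + 1 / (ε * R ^ 2) * eta R x
          + 1 / R * (eta R x * Q x) + 1 / R * (eta R x * A x)) :=
        setIntegral_mono hEi (j3.const_mul B) hpt
    _ = B * (ε * D + 1 / (ε * R ^ 2) * (∫ x in slab, eta R x) + 1 / R * D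
          + 1 / R * ∫ x in slab, eta R x * A x) := by
        rw [integral_const_mul, integral_add j2 (i3.const_mul _),
          integral_add j1 (i1.const_mul _), integral_add (i1.const_mul _) (i2.const_mul _)]
        simp only [integral_const_mul]
        rw [hD]
    _ ≤ B * (ε * D + 1 / (ε * R ^ 2) * (64 * R ^ 2) + 1 / R * D + 1 / R * D) := by
        have := integral_eta_le hRp
        gcongr
    _ = B * (ε * D + 64 * (1 / ε) + 2 * (D / R)) := by field_simp; ring
    _ ≤ 64 * B * (ε * D + 1 / ε + D / R) := by
        have h1 : 0 ≤ ε * D := by positivity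
        have h2 : 0 ≤ D / R := by positivity
        rw [mul_comm 64 B, mul_assoc B 64]
        refine mul_le_mul_of_nonneg_left ?_ hB0
        linarith

end estimate

/-! ### Vanishing of the energy -/

open Filter Topology in
/-- A monotone sequence of at most exponential growth satisfying the recursive energy inequality
vanishes. -/
lemma eq_zero_of_energy_recursion {a : ℕ → ℝ} {C G T : ℝ} (ha : ∀ n, 0 ≤ a n) (hmono : Monotone a)
    (hC : 0 ≤ C) (hT : 0 < T) (hG : ∀ n, a n ≤ G * T ^ n)
    (hrec : ∀ n, ∀ ε > 0, a (n + 1)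
      ≤ C * (ε * (a (n + 2) - a n) + 1 / ε + (a (n + 2) - a n) / 2 ^ (n + 1))) (n : ℕ) :
    a n = 0 := by
  have hpow : Tendsto (fun n : ℕ => (1 / 2 : ℝ) ^ (n + 1)) atTop (𝓝 0) :=
    (tendsto_pow_atTop_nhds_zero_of_lt_one (by norm_num) (by norm_num)).comp
      (tendsto_add_atTop_nat 1)
  have hrec' : ∀ n, ∀ ε > 0, a (n + 1)
      ≤ C * (ε * (a (n + 2) - a n) + 1 / ε + (a (n + 2) - a n) * (1 / 2) ^ (n + 1)) := by
    intro n ε hε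
    have := hrec n ε hε
    rwa [div_eq_mul_one_div (a (n + 2) - a n), ← one_div_pow] at this
  rcases tendsto_atTop_of_monotone hmono with htop | ⟨L, hL⟩
  · exfalso
    set q : ℝ := 1 / (4 * T ^ 2) with hq
    have hq0 : 0 < q := by positivity
    set ε : ℝ := q / (2 * (C + 1)) with hε
    have hε0 : 0 < ε := by positivity
    have hCε : C * ε ≤ q / 2 := by
      rw [hε, mul_div_assoc', div_le_div_iff₀ (by positivity) (by norm_num)]
      nlinarith
    have hev : ∀ᶠ n in atTop, 2 * T ^ 2 * a n ≤ a (n + 2) := by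
      have h1 : ∀ᶠ n : ℕ in atTop, C * (1 / 2 : ℝ) ^ (n + 1) < q / 2 :=
        (by simpa using hpow.const_mul C : Tendsto (fun n : ℕ => C * (1 / 2 : ℝ) ^ (n + 1)) atTop
          (𝓝 0)).eventually_lt_const (by positivity)
      filter_upwards [h1, htop.eventually_ge_atTop (2 * (C * (1 / ε)))] with n h1 h2
      have h3 := hrec' n ε hε0
      have h4 : a n ≤ a (n + 1) := hmono n.le_succ
      have hd : 0 ≤ a (n + 2) - a n := sub_nonneg.2 (hmono (by omega))
      have h5 := mul_le_mul_of_nonneg_right hCε hd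
      have h6 := mul_le_mul_of_nonneg_right h1.le hd
      have h7 : a n / 2 ≤ q * (a (n + 2) - a n) := by linarith
      have h8 : a n / 2 ≤ q * a (n + 2) := h7.trans (by
        have := ha n
        gcongr
        linarith)
      rw [hq, div_mul_eq_mul_div, le_div_iff₀ (by positivity)] at h8
      linarith
    obtain ⟨N, hN⟩ := eventually_atTop.1 (hev.and (htop.eventually_gt_atTop 0))
    have hiter : ∀ k, (2 * T ^ 2) ^ k * a N ≤ a (N + 2 * k) := by
      intro k
      induction k with
      | zero => simp
      | succ k ih =>
        calc (2 * T ^ 2) ^ (k + 1) * a N = 2 * T ^ 2 * ((2 * T ^ 2) ^ k * a N) := by ring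
          _ ≤ 2 * T ^ 2 * a (N + 2 * k) := by gcongr
          _ ≤ a (N + 2 * (k + 1)) := (hN (N + 2 * k) (by omega)).1
    have haN := (hN N le_rfl).2
    have hbd : ∀ k : ℕ, (2 : ℝ) ^ k ≤ G * T ^ N / a N := fun k => by
      have h1 := (hiter k).trans (hG _)
      rw [le_div_iff₀ haN]
      have h2 : 0 < T ^ (2 * k) := by positivity
      refine le_of_mul_le_mul_right ?_ h2
      calc 2 ^ k * a N * T ^ (2 * k) = (2 * T ^ 2) ^ k * a N := by rw [mul_pow, ← pow_mul]; ring
        _ ≤ _ := h1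
        _ = G * T ^ N * T ^ (2 * k) := by rw [pow_add]; ring
    obtain ⟨k, hk⟩ := pow_unbounded_of_one_lt (G * T ^ N / a N) (one_lt_two (α := ℝ))
    exact absurd (hbd k) (not_le.2 hk)
  · have hL1 := hL.comp (tendsto_add_atTop_nat 1)
    have hd : Tendsto (fun n => a (n + 2) - a n) atTop (𝓝 0) := by
      simpa using (hL.comp (tendsto_add_atTop_nat 2)).sub hL
    have hle : ∀ ε > 0, L ≤ C * (1 / ε) := fun ε hε => by
      refine le_of_tendsto_of_tendsto' hL1 ?_ fun n => hrec' n ε hε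
      have := (((hd.const_mul ε).add_const (1 / ε)).add (hd.mul hpow)).const_mul C
      simpa using this
    have hL0 : L ≤ 0 := by
      by_contra! hpos
      have := hle (2 * C / L + 1) (by positivity)
      rw [mul_one_div, le_div_iff₀ (by positivity), mul_add, mul_div_cancel₀ _ hpos.ne'] at this
      linarith
    exact le_antisymm ((hmono.ge_of_tendsto hL n).trans hL0) (ha n)

section conclusion
variable {δ M : ℝ} {u b v : V3 → V3} {p : V3 → ℝ}

lemma chi_antitone : Antitone chi := fun s t h =>
  Real.smoothTransition.monotone (by linarith)

lemma cut_mono {R R' : ℝ} (hR : 0 < R) (h : R ≤ R') (x : V3) : cut R x ≤ cut R' x :=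
  chi_antitone (div_le_div_of_nonneg_left (rsq_nonneg x) (by positivity) (by gcongr))

lemma energy_nonneg (u b : V3 → V3) (R : ℝ) : 0 ≤ energy u b R :=
  integral_nonneg fun x => mul_nonneg (cut_nonneg R x)
    (add_nonneg (gradSq_nonneg u x) (gradSq_nonneg b x))

lemma Adm.energy_mono (hu : Adm M u) (hb : Adm M b) {R R' : ℝ} (hR : 0 < R) (h : R ≤ R') :
    energy u b R ≤ energy u b R' :=
  setIntegral_mono (hu.integrableOn_cut_mul hb hR) (hu.integrableOn_cut_mul hb (hR.trans_le h))
    fun x => mul_le_mul_of_nonneg_right (cut_mono hR h x)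
      (add_nonneg (gradSq_nonneg u x) (gradSq_nonneg b x))

lemma Adm.energy_le_integral_cylSet (hu : Adm M u) (hb : Adm M b) {R : ℝ} (hR : 0 < R) :
    energy u b R ≤ ∫ x in cylSet (2 * R), (gradSq u x + gradSq b x) := by
  have hsub : cylSet (2 * R) ⊆ slab := fun x hx => hx.1
  have hbox : cylSet (2 * R) ⊆ box (2 * R) := fun x hx => mem_box.2
    ⟨abs_le.1 ((abs_zero_le_nr x).trans hx.2), abs_le.1 ((abs_one_le_nr x).trans hx.2), hx.1⟩
  have hQ : Continuous fun x => gradSq u x + gradSq b x :=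
    hu.contDiff_gradSq.continuous.add hb.contDiff_gradSq.continuous
  have hi : IntegrableOn (fun x => gradSq u x + gradSq b x) (cylSet (2 * R)) :=
    (hQ.continuousOn.integrableOn_compact isCompact_Icc).mono_set hbox
  rw [energy, setIntegral_eq_of_subset_of_forall_sdiff_eq_zero measurableSet_slab hsub
    fun x hx => ?_]
  · exact setIntegral_mono ((hu.integrableOn_cut_mul hb hR).mono_set hsub) hi fun x =>
      mul_le_of_le_one_left (add_nonneg (gradSq_nonneg u x) (gradSq_nonneg b x)) (cut_le_one R x)
  · have : 2 * R ≤ nr x := by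
      by_contra! hlt
      exact hx.2 ⟨hx.1, hlt.le⟩
    rw [cut_eq_zero hR this, zero_mul]

lemma Sol.energy_eq_zero (h : Sol δ M u b p) (hδ : δ ∈ Set.Icc (0 : ℝ) 1)
    (hgrow : DirichletGrowth u b) (n : ℕ) : energy u b (2 ^ n) = 0 := by
  obtain ⟨C, hC, α, hα, hR⟩ := hgrow
  obtain ⟨K, hK, hE⟩ := h.energy_le hδ
  refine eq_zero_of_energy_recursion (a := fun n => energy u b (2 ^ n)) (C := K)
    (G := C * 2 ^ α) (T := 2 ^ α) (fun n => energy_nonneg u b _) (fun m n hmn => ?_) hK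
    (by positivity) (fun n => ?_) (fun n ε hε => ?_) n
  · exact h.admU.energy_mono h.admB (by positivity) (pow_le_pow_right₀ one_le_two hmn)
  · have h1 : (1 : ℝ) ≤ 2 ^ n := one_le_pow₀ one_le_two
    refine (h.admU.energy_le_integral_cylSet h.admB (by positivity)).trans
      ((hR (2 * 2 ^ n) (by linarith)).trans_eq ?_)
    rw [Real.mul_rpow (by norm_num) (by positivity), Real.rpow_pow_comm (by norm_num), mul_assoc]
  · have h1 : (1 : ℝ) ≤ 2 ^ (n + 1) := one_le_pow₀ one_le_two
    have := hE (2 ^ (n + 1)) h1 ε hε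
    have e1 : (2 : ℝ) * 2 ^ (n + 1) = 2 ^ (n + 2) := by ring
    have e2 : (2 : ℝ) ^ (n + 1) / 2 = 2 ^ n := by ring
    rwa [e1, e2] at this

lemma eq_zero_of_ae_slab {f : V3 → ℝ} (hf : Continuous f) (hp : ZPer f)
    (h0 : f =ᵐ[volume.restrict slab] 0) (x : V3) : f x = 0 := by
  set U : Set V3 := {x | 0 < x 2 ∧ x 2 < 1} with hU
  have hUo : IsOpen U := (isOpen_lt continuous_const (continuous_apply 2)).inter
    (isOpen_lt (continuous_apply 2) continuous_const)
  have hUs : U ⊆ slab := fun x hx => ⟨hx.1.le, hx.2.le⟩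
  have h1 : Set.EqOn f 0 U := Measure.eqOn_open_of_ae_eq
    (ae_restrict_of_ae_restrict_of_subset hUs h0) hUo hf.continuousOn continuousOn_const
  set y : V3 := ![x 0, x 1, 0] with hy
  set g : ℝ → ℝ := fun t => f (zsh y t) with hg
  have hgc : Continuous g := hf.comp (continuous_const.zsh continuous_id)
  have hz : ∀ t, zsh y t 2 = t := fun t => by
    rw [zsh, Pi.add_apply, Pi.single_eq_same]
    exact zero_add t
  have h2 : Set.EqOn g 0 (Set.Ioo 0 1) := fun t ht =>
    h1 (show 0 < zsh y t 2 ∧ zsh y t 2 < 1 by rw [hz]; exact ht)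
  have h3 : Set.EqOn g 0 (Set.Icc 0 1) := by
    rw [← closure_Ioo (zero_ne_one (α := ℝ))]
    exact h2.closure hgc continuous_const
  have hper : Function.Periodic g 1 := fun t => by
    have e : zsh y (t + 1) = zsh y t + Pi.single 2 1 := by
      simp only [zsh, Pi.single_add, add_assoc]
    simp only [hg, e, hp _]
  have hx : x = zsh y (x 2) := by
    ext i; fin_cases i <;> simp [zsh, hy]
  rw [hx]
  change g (x 2) = 0
  rw [← hper.sub_int_mul_eq ⌊x 2⌋, mul_one]
  exact h3 ⟨Int.fract_nonneg _, (Int.fract_lt_one _).le⟩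

lemma Sol.gradSq_add_eq_zero (h : Sol δ M u b p) (hδ : δ ∈ Set.Icc (0 : ℝ) 1)
    (hgrow : DirichletGrowth u b) (x : V3) : gradSq u x + gradSq b x = 0 := by
  obtain ⟨n, hn⟩ := pow_unbounded_of_one_lt (nr x) (one_lt_two (α := ℝ))
  have hp : (0 : ℝ) < 2 ^ n := by positivity
  have hc : Continuous fun x => cut (2 ^ n) x * (gradSq u x + gradSq b x) :=
    (contDiff_cut (n := 1) _).continuous.mul (h.admU.contDiff_gradSq.continuous.add
      h.admB.contDiff_gradSq.continuous)
  have h0 := (integral_eq_zero_iff_of_nonneg (μ := volume.restrict slab)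
    (fun x => mul_nonneg (cut_nonneg (2 ^ n) x)
      (add_nonneg (gradSq_nonneg u x) (gradSq_nonneg b x)))
    (h.admU.integrableOn_cut_mul h.admB hp)).1 (h.energy_eq_zero hδ hgrow n)
  have := eq_zero_of_ae_slab hc
    ((zPer_cut _).mul (h.admU.zPer_gradSq.add h.admB.zPer_gradSq)) h0 x
  rwa [cut_eq_one hp hn.le, one_mul] at this

lemma Adm.eq_of_gradSq_eq_zero (hv : Adm M v) (h : ∀ x, gradSq v x = 0) (x : V3) : v x = v 0 := by
  ext i
  refine is_const_of_fderiv_eq_zero (f := fun x => v x i)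
    ((hv.contDiff_one i).differentiable (by simp)) (fun y => ?_) x 0
  ext w
  have h0 : ∀ j, pd j (fun y => v y i) y = 0 := fun j =>
    pow_eq_zero_iff two_ne_zero |>.1 (le_antisymm ((sq_pd_le_gradSq v i j y).trans_eq (h y))
      (sq_nonneg _))
  simp [fderiv_apply_eq_sum_pd, h0]

lemma nr_mul_ur (v : V3 → V3) (x : V3) : nr x * ur v x = x 0 * v x 0 + x 1 * v x 1 := by
  by_cases h : nr x = 0
  · have h0 : x 0 = 0 := abs_nonpos_iff.1 ((abs_zero_le_nr x).trans_eq h)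
    have h1 : x 1 = 0 := abs_nonpos_iff.1 ((abs_one_le_nr x).trans_eq h)
    simp [h, h0, h1]
  · exact mul_div_cancel₀ _ h

lemma Adm.of_bounded (hv : ContDiff ℝ (⊤ : ℕ∞) v) (hb : ∀ x, ‖v x‖ ≤ M) (hp : PeriodicZ v)
    (hd : DivFree v) (hr : ∀ x, |nr x * ur v x| ≤ M) : Adm M v where
  smooth := contDiff_pi.1 hv
  bound x i := (norm_le_pi_norm (v x) i).trans (hb x)
  per i x := by
    have e : ![x 0, x 1, x 2 + 1] = x + Pi.single 2 1 := by ext i; fin_cases i <;> simp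
    have := hp x
    rw [e] at this
    exact congrFun this i
  div := hd
  radial x := by rw [← nr_mul_ur]; exact hr x

end conclusion

/-- Liouville theorem for MHD/Hall–MHD in the slab when
`|x'| u^r` and `|x'| b^r` are bounded. -/
theorem liouville_rur_bounded (δ : ℝ) (hδ : δ ∈ Set.Icc (0:ℝ) 1)
    (u b : V3 → V3) (p : V3 → ℝ)
    (hu : ContDiff ℝ (⊤ : ℕ∞) u) (hb : ContDiff ℝ (⊤ : ℕ∞) b) (hp : ContDiff ℝ (⊤ : ℕ∞) p)
    (hubd : Bounded3 u) (hbbd : Bounded3 b)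
    (hup : PeriodicZ u) (hbp : PeriodicZ b)
    (hsol : IsMHD δ u b p)
    (hgrow : DirichletGrowth u b)
    (hrur : ∃ M : ℝ, ∀ x, |nr x * ur u x| ≤ M ∧ |nr x * ur b x| ≤ M) :
    (∃ cu : V3, ∀ x, u x = cu) ∧ (∃ cb : V3, ∀ x, b x = cb) := by
  obtain ⟨Mu, hMu⟩ := hubd
  obtain ⟨Mb, hMb⟩ := hbbd
  obtain ⟨Mr, hMr⟩ := hrur
  obtain ⟨hmom, hmag, hdu, hdb⟩ := hsol
  set M := max (max Mu Mb) Mr with hM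
  have h1 : Mu ≤ M := (le_max_left _ _).trans (le_max_left _ _)
  have h2 : Mb ≤ M := (le_max_right _ _).trans (le_max_left _ _)
  have h3 : Mr ≤ M := le_max_right _ _
  have h : Sol δ M u b p :=
    ⟨.of_bounded hu (fun x => (hMu x).trans h1) hup hdu fun x => (hMr x).1.trans h3,
      .of_bounded hb (fun x => (hMb x).trans h2) hbp hdb fun x => (hMr x).2.trans h3,
      hp, hmom, hmag⟩
  have hQ := h.gradSq_add_eq_zero hδ hgrow
  have hu0 : ∀ x, gradSq u x = 0 := fun x => by
    linarith [hQ x, gradSq_nonneg u x, gradSq_nonneg b x]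
  have hb0 : ∀ x, gradSq b x = 0 := fun x => by
    linarith [hQ x, gradSq_nonneg u x, gradSq_nonneg b x]
  exact ⟨⟨u 0, h.admU.eq_of_gradSq_eq_zero hu0⟩, ⟨b 0, h.admB.eq_of_gradSq_eq_zero hb0⟩⟩
end
end

section
/- Let u : ℝ³ → ℝ³ be smooth, divergence-free, and 1-periodic in x₃. If u^θ is axisymmetric, or if u^r is axisymmetric, then for every r > 0 and every θ one has ∫₀¹ u^r(r cosθ, r sinθ, z) dz = 0. -/
open MeasureTheory

noncomputable section

theorem hasDerivAt_intervalIntegral_of_continuous {F F' : ℝ → ℝ → ℝ} (a b : ℝ)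
    (hF : ∀ x, Continuous (F x)) (hF' : Continuous (Function.uncurry F'))
    (hd : ∀ x t, HasDerivAt (fun y => F y t) (F' x t) x) (x₀ : ℝ) :
    HasDerivAt (fun x => ∫ t in a..b, F x t) (∫ t in a..b, F' x₀ t) x₀ := by
  obtain ⟨C, hC⟩ := ((isCompact_closedBall x₀ 1).prod
    (isCompact_uIcc (a := a) (b := b))).exists_bound_of_continuousOn hF'.continuousOn
  have hF'₀ : Continuous (F' x₀) := hF'.comp (Continuous.prodMk_right x₀)
  refine (intervalIntegral.hasDerivAt_integral_of_dominated_loc_of_deriv_le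
    (F := F) (F' := F') (bound := fun _ => C) (Metric.closedBall_mem_nhds x₀ one_pos)
    (.of_forall fun x => (hF x).aestronglyMeasurable) ((hF x₀).intervalIntegrable a b)
    hF'₀.aestronglyMeasurable ?_ intervalIntegrable_const
    (.of_forall fun t _ x _ => hd x t)).2
  exact .of_forall fun t ht x hx => hC (x, t) ⟨hx, Set.uIoc_subset_uIcc ht⟩

theorem hasDerivAt_comp_curve {f : V3 → ℝ} (hf : Differentiable ℝ f) {c : ℝ → V3} {v : V3}
    {t : ℝ} (hc : HasDerivAt c v t) :
    HasDerivAt (fun s => f (c s)) (∑ i, v i * pd i f (c t)) t := by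
  refine ((hf (c t)).hasFDerivAt.comp_hasDerivAt t hc).congr_deriv ?_
  conv_lhs => rw [pi_eq_sum_univ' v, map_sum]
  refine Finset.sum_congr rfl fun i _ => ?_
  rw [map_smul, smul_eq_mul, pd]

theorem continuous_pd {f : V3 → ℝ} (hf : ContDiff ℝ 1 f) (i : Fin 3) : Continuous (pd i f) :=
  (hf.continuous_fderiv one_ne_zero).clm_apply continuous_const

theorem hasDerivAt_cylPt_r (r θ z : ℝ) :
    HasDerivAt (fun s => cylPt s θ z) ![Real.cos θ, Real.sin θ, 0] r := by
  rw [hasDerivAt_pi]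
  intro i
  fin_cases i
  · simpa [cylPt] using (hasDerivAt_id r).mul_const (Real.cos θ)
  · simpa [cylPt] using (hasDerivAt_id r).mul_const (Real.sin θ)
  · simpa [cylPt] using hasDerivAt_const r z

theorem hasDerivAt_cylPt_theta (r θ z : ℝ) :
    HasDerivAt (fun s => cylPt r s z) ![-(r * Real.sin θ), r * Real.cos θ, 0] θ := by
  rw [hasDerivAt_pi]
  intro i
  fin_cases i
  · simpa [cylPt] using (Real.hasDerivAt_cos θ).const_mul r
  · simpa [cylPt] using (Real.hasDerivAt_sin θ).const_mul r
  · simpa [cylPt] using hasDerivAt_const θ z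

theorem hasDerivAt_cylPt_z (r θ z : ℝ) :
    HasDerivAt (fun s => cylPt r θ s) ![0, 0, 1] z := by
  rw [hasDerivAt_pi]
  intro i
  fin_cases i
  · simpa [cylPt] using hasDerivAt_const z (r * Real.cos θ)
  · simpa [cylPt] using hasDerivAt_const z (r * Real.sin θ)
  · simpa [cylPt] using hasDerivAt_id' z

theorem continuous_cylPt : Continuous fun p : ℝ × ℝ × ℝ => cylPt p.1 p.2.1 p.2.2 := by
  refine continuous_pi fun i => ?_
  fin_cases i <;> simp only [cylPt] <;> simp <;> fun_prop

/-- The radial derivative `∂_r (r u^r)`. -/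
def radialFluxDeriv (u : V3 → V3) (r θ z : ℝ) : ℝ :=
  compR u r θ z + r * (Real.cos θ * (Real.cos θ * pd 0 (fun y => u y 0) (cylPt r θ z)
      + Real.sin θ * pd 1 (fun y => u y 0) (cylPt r θ z))
    + Real.sin θ * (Real.cos θ * pd 0 (fun y => u y 1) (cylPt r θ z)
      + Real.sin θ * pd 1 (fun y => u y 1) (cylPt r θ z)))

theorem hasDerivAt_radialFlux {u : V3 → V3} (hu : ContDiff ℝ 1 u) (r θ z : ℝ) :
    HasDerivAt (fun s => s * compR u s θ z) (radialFluxDeriv u r θ z) r := by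
  have hd (i : Fin 3) := hasDerivAt_comp_curve
    ((contDiff_pi.1 hu i).differentiable one_ne_zero) (hasDerivAt_cylPt_r r θ z)
  refine ((hasDerivAt_id r).mul
    (((hd 0).const_mul (Real.cos θ)).add ((hd 1).const_mul (Real.sin θ)))).congr_deriv ?_
  simp [radialFluxDeriv, compR, Fin.sum_univ_three]

/-- The divergence-free condition in cylindrical coordinates:
`∂_θ u^θ = -∂_r (r u^r) - r ∂_z u^z`. -/
theorem hasDerivAt_compTheta {u : V3 → V3} (hu : ContDiff ℝ 1 u) (hdiv : DivFree u)
    (r θ z : ℝ) :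
    HasDerivAt (fun s => compTheta u r s z)
      (-radialFluxDeriv u r θ z - r * pd 2 (fun y => u y 2) (cylPt r θ z)) θ := by
  have hd (i : Fin 3) := hasDerivAt_comp_curve
    ((contDiff_pi.1 hu i).differentiable one_ne_zero) (hasDerivAt_cylPt_theta r θ z)
  have h := hdiv (cylPt r θ z)
  rw [Fin.sum_univ_three] at h
  refine (((Real.hasDerivAt_sin θ).neg.mul (hd 0)).add
    ((Real.hasDerivAt_cos θ).mul (hd 1))).congr_deriv ?_
  simp only [radialFluxDeriv, compR, Fin.sum_univ_three, Matrix.cons_val_zero,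
    Matrix.cons_val_one, Matrix.cons_val, Pi.neg_apply]
  linear_combination r * h
    + r * (pd 0 (fun y => u y 0) (cylPt r θ z) + pd 1 (fun y => u y 1) (cylPt r θ z))
      * Real.sin_sq_add_cos_sq θ

theorem integral_pd_two_eq_zero {u : V3 → V3} (hu : ContDiff ℝ 1 u) (hper : PeriodicZ u)
    (r θ : ℝ) : ∫ z in (0:ℝ)..1, pd 2 (fun y => u y 2) (cylPt r θ z) = 0 := by
  have hu2 := contDiff_pi.1 hu 2
  have hcyl : Continuous fun z => cylPt r θ z := continuous_cylPt.comp (by fun_prop :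
    Continuous fun z : ℝ => (r, θ, z))
  rw [intervalIntegral.integral_eq_sub_of_hasDerivAt (f := fun z => u (cylPt r θ z) 2)]
  · have h := hper (cylPt r θ 0)
    simp only [cylPt, Matrix.cons_val_zero, Matrix.cons_val_one, Matrix.cons_val, zero_add] at h
    simp [cylPt, h]
  · intro z _
    simpa [Fin.sum_univ_three] using
      hasDerivAt_comp_curve (hu2.differentiable one_ne_zero) (hasDerivAt_cylPt_z r θ z)
  · exact ((continuous_pd hu2 2).comp hcyl).intervalIntegrable 0 1

section Continuity

variable {u : V3 → V3} {X : Type*} [TopologicalSpace X] {r θ z : X → ℝ}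

theorem continuous_comp_cylPt {f : V3 → ℝ} (hf : Continuous f) (hr : Continuous r)
    (hθ : Continuous θ) (hz : Continuous z) :
    Continuous fun x => f (cylPt (r x) (θ x) (z x)) :=
  hf.comp (continuous_cylPt.comp (hr.prodMk (hθ.prodMk hz)))

theorem continuous_compR (hu : Continuous u) (hr : Continuous r)
    (hθ : Continuous θ) (hz : Continuous z) :
    Continuous fun x => compR u (r x) (θ x) (z x) := by
  have hcos := Real.continuous_cos.comp hθ
  have hsin := Real.continuous_sin.comp hθ
  have h (i : Fin 3) := continuous_comp_cylPt (continuous_pi_iff.1 hu i) hr hθ hz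
  exact (hcos.mul (h 0)).add (hsin.mul (h 1))

theorem continuous_compTheta (hu : Continuous u) (hr : Continuous r)
    (hθ : Continuous θ) (hz : Continuous z) :
    Continuous fun x => compTheta u (r x) (θ x) (z x) := by
  have hcos := Real.continuous_cos.comp hθ
  have hsin := Real.continuous_sin.comp hθ
  have h (i : Fin 3) := continuous_comp_cylPt (continuous_pi_iff.1 hu i) hr hθ hz
  exact (hsin.neg.mul (h 0)).add (hcos.mul (h 1))

theorem continuous_radialFluxDeriv (hu : ContDiff ℝ 1 u) (hr : Continuous r)
    (hθ : Continuous θ) (hz : Continuous z) :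
    Continuous fun x => radialFluxDeriv u (r x) (θ x) (z x) := by
  have hcos := Real.continuous_cos.comp hθ
  have hsin := Real.continuous_sin.comp hθ
  have h (i j : Fin 3) :=
    continuous_comp_cylPt (continuous_pd (contDiff_pi.1 hu i) j) hr hθ hz
  exact (continuous_compR hu.continuous hr hθ hz).add (hr.mul
    ((hcos.mul ((hcos.mul (h 0 0)).add (hsin.mul (h 0 1)))).add
      (hsin.mul ((hcos.mul (h 1 0)).add (hsin.mul (h 1 1))))))

end Continuity

theorem hasDerivAt_integral_radialFlux {u : V3 → V3} (hu : ContDiff ℝ 1 u) (r θ : ℝ) :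
    HasDerivAt (fun s => ∫ z in (0:ℝ)..1, s * compR u s θ z)
      (∫ z in (0:ℝ)..1, radialFluxDeriv u r θ z) r :=
  hasDerivAt_intervalIntegral_of_continuous (F := fun s z => s * compR u s θ z)
    (F' := fun s z => radialFluxDeriv u s θ z) 0 1
    (fun _ => continuous_const.mul
      (continuous_compR hu.continuous continuous_const continuous_const continuous_id))
    (continuous_radialFluxDeriv hu continuous_fst continuous_const continuous_snd)
    (fun s z => hasDerivAt_radialFlux hu s θ z) r

theorem hasDerivAt_integral_compTheta {u : V3 → V3} (hu : ContDiff ℝ 1 u) (hdiv : DivFree u)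
    (hper : PeriodicZ u) (r θ : ℝ) :
    HasDerivAt (fun s => ∫ z in (0:ℝ)..1, compTheta u r s z)
      (-∫ z in (0:ℝ)..1, radialFluxDeriv u r θ z) θ := by
  have hpd := continuous_pd (contDiff_pi.1 hu 2) 2
  convert hasDerivAt_intervalIntegral_of_continuous (F := fun s z => compTheta u r s z)
    (F' := fun s z => -radialFluxDeriv u r s z - r * pd 2 (fun y => u y 2) (cylPt r s z)) 0 1
    (fun _ => continuous_compTheta hu.continuous continuous_const continuous_const continuous_id)
    ((continuous_radialFluxDeriv hu continuous_const continuous_fst continuous_snd).neg.sub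
      (continuous_const.mul
        (continuous_comp_cylPt hpd continuous_const continuous_fst continuous_snd)))
    (fun s z => hasDerivAt_compTheta hu hdiv r s z) θ using 1
  rw [intervalIntegral.integral_sub, intervalIntegral.integral_neg,
    intervalIntegral.integral_const_mul, integral_pd_two_eq_zero hu hper, mul_zero, sub_zero]
  · exact (continuous_radialFluxDeriv hu continuous_const continuous_const
      continuous_id).neg.intervalIntegrable 0 1
  · exact (continuous_const.mul (continuous_comp_cylPt hpd continuous_const continuous_const
      continuous_id)).intervalIntegrable 0 1

theorem integral_radialFluxDeriv_eq_zero {u : V3 → V3} (hu : ContDiff ℝ 1 u)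
    (hdiv : DivFree u) (hper : PeriodicZ u)
    (hax : AxiSym (compTheta u) ∨ AxiSym (compR u)) (r θ : ℝ) :
    ∫ z in (0:ℝ)..1, radialFluxDeriv u r θ z = 0 := by
  have hW := hasDerivAt_integral_compTheta hu hdiv hper r
  rcases hax with hax | hax
  · have hconst : (fun s => ∫ z in (0:ℝ)..1, compTheta u r s z)
        = fun _ => ∫ z in (0:ℝ)..1, compTheta u r θ z := by
      funext s
      simp only [hax r s θ]
    have h := hW θ
    rw [hconst] at h
    exact neg_eq_zero.1 (h.unique (hasDerivAt_const θ _))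
  · have hindep (s : ℝ) : ∫ z in (0:ℝ)..1, radialFluxDeriv u r s z
        = ∫ z in (0:ℝ)..1, radialFluxDeriv u r θ z := by
      refine (hasDerivAt_integral_radialFlux hu r s).unique ?_
      simpa only [hax _ s θ] using hasDerivAt_integral_radialFlux hu r θ
    simp only [hindep] at hW
    obtain ⟨s, -, hs⟩ := exists_hasDerivAt_eq_zero Real.two_pi_pos
      (fun s _ => (hW s).continuousAt.continuousWithinAt)
      (by simp [compTheta, cylPt]) fun s _ => hW s
    exact neg_eq_zero.1 hs

/-- The radial component has zero mean over a period in `z`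
when `u^θ` or `u^r` is axisymmetric. -/
theorem ur_zero_mean_z (u : V3 → V3)
    (hu : ContDiff ℝ (⊤ : ℕ∞) u) (hud : DivFree u) (hup : PeriodicZ u)
    (hax : AxiSym (compTheta u) ∨ AxiSym (compR u)) :
    ∀ r > (0:ℝ), ∀ θ : ℝ, (∫ z in (0:ℝ)..1, compR u r θ z) = 0 := by
  intro r hr θ
  have hu1 : ContDiff ℝ 1 u := hu.of_le (by exact_mod_cast le_top)
  have hflux := is_const_of_deriv_eq_zero
    (fun s => (hasDerivAt_integral_radialFlux hu1 s θ).differentiableAt)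
    (fun s => (hasDerivAt_integral_radialFlux hu1 s θ).deriv.trans
      (integral_radialFluxDeriv_eq_zero hu1 hud hup hax s θ)) r 0
  simpa [hr.ne'] using hflux
end
end
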